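/- arXiv:2409.12857 — 9 statements merged into one kernel-verified Lean document; each statement's English description precedes it below -/
import Mathlib

section
/- Let X be a finite-dimensional normed space over the real field. Then the following are equivalent: (1) there exists an inner product ⟨·,·⟩ on X such that ‖x‖² = ⟨x,x⟩ for every x ∈ X; (2) for every linear operator u : X → X, the set N(u) = { x ∈ X : ‖u(x)‖ = ‖u‖_op · ‖x‖ } is a linear subspace of X. -/
theorem nv_attain {E F : Type*} [NormedAddCommGroup E] [NormedSpace ℝ E] [FiniteDimensional ℝ E]
    [Nontrivial E] [NormedAddCommGroup F] [NormedSpace ℝ F] (u : E →L[ℝ] F) :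
    ∃ x : E, ‖x‖ = 1 ∧ ‖u x‖ = ‖u‖ := by
  have : ProperSpace E := FiniteDimensional.proper ℝ E
  have hne : (Metric.sphere (0 : E) 1).Nonempty := NormedSpace.sphere_nonempty.2 zero_le_one
  obtain ⟨x, hx, hmax⟩ := (isCompact_sphere (0 : E) 1).exists_isMaxOn hne
    (f := fun x => ‖u x‖) (by fun_prop)
  have hx1 : ‖x‖ = 1 := by simpa using hx
  refine ⟨x, hx1, le_antisymm (by simpa [hx1] using u.le_opNorm x) ?_⟩
  refine u.opNorm_le_bound (norm_nonneg _) fun y => ?_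
  by_cases hy : y = 0
  · simp [hy]
  have hy' : 0 < ‖y‖ := norm_pos_iff.2 hy
  have h := hmax (a := ‖y‖⁻¹ • y) (by simp [norm_smul, hy'.ne'])
  simp only [Set.mem_ofPred_eq, map_smul, norm_smul, norm_inv, norm_norm] at h
  rw [inv_mul_le_iff₀ hy'] at h
  linarith

theorem nv_perturb {E F : Type*} [NormedAddCommGroup E] [NormedSpace ℝ E] [FiniteDimensional ℝ E]
    [Nontrivial E] [NormedAddCommGroup F] [NormedSpace ℝ F] (u h : E →L[ℝ] F)
    (H : ∀ y : E, ‖y‖ = 1 → ‖u y‖ = ‖u‖ → ‖(u + h) y‖ < ‖u‖) :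
    ∃ ε : ℝ, ‖u + ε • h‖ < ‖u‖ := by
  have : ProperSpace E := FiniteDimensional.proper ℝ E
  set K : Set E := Metric.sphere (0 : E) 1 ∩ {y | ‖u‖ ≤ ‖(u + h) y‖} with hK
  have hKc : IsCompact K := (isCompact_sphere (0 : E) 1).inter_right
    (isClosed_le continuous_const (by fun_prop))
  have hδ : ∃ δ > 0, ∀ y ∈ K, ‖u y‖ ≤ ‖u‖ - δ := by
    rcases K.eq_empty_or_nonempty with h0 | h0
    · exact ⟨1, one_pos, by simp [h0]⟩
    obtain ⟨x, hx, hmax⟩ := hKc.exists_isMaxOn h0 (f := fun x => ‖u x‖) (by fun_prop)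
    have hx1 : ‖x‖ = 1 := by simpa using hx.1
    have hlt : ‖u x‖ < ‖u‖ := by
      refine lt_of_le_of_ne (by simpa [hx1] using u.le_opNorm x) fun he => ?_
      exact absurd (H x hx1 he) (not_lt.2 hx.2)
    refine ⟨‖u‖ - ‖u x‖, by linarith, fun y hy => ?_⟩
    have := hmax hy
    simp only [Set.mem_ofPred_eq] at this
    linarith
  obtain ⟨δ, hδ0, hδ⟩ := hδ
  have hh := norm_nonneg h
  set ε : ℝ := min 1 (δ / (2 * (‖h‖ + 1))) with hε
  have hε0 : 0 < ε := by positivity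
  have hε1 : ε ≤ 1 := min_le_left _ _
  have hε2 : ε * ‖h‖ < δ := by
    have h1 : ε ≤ δ / (2 * (‖h‖ + 1)) := min_le_right _ _
    rw [le_div_iff₀ (by positivity)] at h1
    nlinarith
  refine ⟨ε, ?_⟩
  obtain ⟨y, hy1, hy⟩ := nv_attain (u + ε • h)
  rw [← hy]
  have huy : ‖u y‖ ≤ ‖u‖ := by simpa [hy1] using u.le_opNorm y
  by_cases hyK : y ∈ K
  · have h1 := hδ y hyK
    have h2 : ‖h y‖ ≤ ‖h‖ := by simpa [hy1] using h.le_opNorm y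
    calc ‖(u + ε • h) y‖ ≤ ‖u y‖ + ‖ε • h y‖ := norm_add_le _ _
      _ = ‖u y‖ + ε * ‖h y‖ := by rw [norm_smul, Real.norm_of_nonneg hε0.le]
      _ < ‖u‖ := by nlinarith
  · have h1 : ‖(u + h) y‖ < ‖u‖ := by
      by_contra hc
      exact hyK ⟨by simpa using hy1, not_lt.1 hc⟩
    calc ‖(u + ε • h) y‖ = ‖(1 - ε) • u y + ε • (u + h) y‖ := by
          congr 1
          simp only [add_apply, smul_apply]
          module
      _ ≤ ‖(1 - ε) • u y‖ + ‖ε • (u + h) y‖ := norm_add_le _ _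
      _ = (1 - ε) * ‖u y‖ + ε * ‖(u + h) y‖ := by
          rw [norm_smul, norm_smul, Real.norm_of_nonneg hε0.le,
            Real.norm_of_nonneg (by linarith : 0 ≤ 1 - ε)]
      _ < ‖u‖ := by nlinarith

/-- norming functional in a plane: kernel decomposition -/
theorem nv_decomp {Z : Type*} [NormedAddCommGroup Z] [NormedSpace ℝ Z]
    (hZ : Module.finrank ℝ Z = 2) (v : Z) (hv : v ≠ 0) (w : Z →L[ℝ] ℝ) (hwv : w v = 0)
    (z1 : Z) (hz1 : w z1 ≠ 0) (z : Z) : ∃ a s : ℝ, z = a • z1 + s • v := by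
  have hli : LinearIndependent ℝ ![z1, v] := by
    rw [LinearIndependent.pair_iff]
    intro s t h
    have h1 := congrArg w h
    simp [hwv, hz1] at h1
    subst h1
    simpa [hv] using h
  have hsp := hli.span_eq_top_of_card_eq_finrank (by simp [hZ])
  have : z ∈ Submodule.span ℝ (Set.range ![z1, v]) := by rw [hsp]; trivial
  simp only [Matrix.range_cons, Matrix.range_empty, Set.union_empty, Set.singleton_union,
    Submodule.mem_span_pair] at this
  obtain ⟨a, b, h⟩ := this
  exact ⟨a, b, h.symm⟩

theorem nv_main {X Z : Type*} [NormedAddCommGroup X] [NormedSpace ℝ X] [FiniteDimensional ℝ X]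
    [NormedAddCommGroup Z] [NormedSpace ℝ Z] (hZ : Module.finrank ℝ Z = 2)
    (hN : ∀ u : X →L[ℝ] Z, ∃ S : Submodule ℝ X, (S : Set X) = {x : X | ‖u x‖ = ‖u‖ * ‖x‖})
    (p : X) (hp : ‖p‖ = 1) (v : Z) (hv : ‖v‖ = 1) (q : X →L[ℝ] ℝ) (hq : ‖q‖ = 1)
    (hqp : q p = 0) (w : Z →L[ℝ] ℝ) (hw : ‖w‖ = 1) (hwv : w v = 0) :
    ∃ u : X →L[ℝ] Z, u p = v ∧ (∀ x, w (u x) = q x) ∧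
      ∃ S : Submodule ℝ X, (S : Set X) = {x : X | ‖u x‖ = ‖u‖ * ‖x‖} ∧
        2 ≤ Module.finrank ℝ S := by
  have : FiniteDimensional ℝ Z := Module.finite_of_finrank_pos (by omega)
  have hp0 : p ≠ 0 := by rintro rfl; simp at hp
  have hv0 : v ≠ 0 := by rintro rfl; simp at hv
  have : Nontrivial X := ⟨p, 0, hp0⟩
  have : Nontrivial Z := ⟨v, 0, hv0⟩
  obtain ⟨z1, hz1n, hz1⟩ := nv_attain w
  obtain ⟨x0, hx0n, hx0⟩ := nv_attain q
  rw [hw] at hz1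
  rw [hq] at hx0
  have hwz1 : w z1 ≠ 0 := by intro h; simp [h] at hz1
  have hqx0 : q x0 ≠ 0 := by intro h; simp [h] at hx0
  set A : Set (X →L[ℝ] Z) := {u | u p = v ∧ ∀ x, w (u x) = q x} with hA
  have hAc : IsClosed A := by
    have : A = {u | u p = v} ∩ ⋂ x, {u | w (u x) = q x} := by ext u; simp [hA]
    rw [this]
    refine IsClosed.inter (isClosed_eq (by fun_prop) continuous_const) (isClosed_iInter fun x => ?_)
    exact isClosed_eq (by fun_prop) continuous_const
  obtain ⟨r0, -, hr0⟩ := exists_dual_vector ℝ p (by simp [hp])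
  have hAn : A.Nonempty := by
    refine ⟨r0.smulRight v + q.smulRight ((w z1)⁻¹ • z1), ?_, fun x => ?_⟩
    · simp [hr0, hqp, hp]
    · simp [hwv, hwz1]
  have : ProperSpace (X →L[ℝ] Z) := FiniteDimensional.proper ℝ _
  obtain ⟨u, huA, hmin⟩ := hAc.exists_infDist_eq_dist hAn 0
  have hmin' : ∀ t ∈ A, ‖u‖ ≤ ‖t‖ := by
    intro t ht
    have h1 := Metric.infDist_le_dist_of_mem (x := (0 : X →L[ℝ] Z)) ht
    rw [hmin] at h1
    simpa using h1
  obtain ⟨S, hS⟩ := hN u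
  have hmem : ∀ x, x ∈ S ↔ ‖u x‖ = ‖u‖ * ‖x‖ := fun x => by
    rw [← SetLike.mem_coe, hS]; rfl
  refine ⟨u, huA.1, huA.2, S, hS, ?_⟩
  by_contra hlt
  have hle : Module.finrank ℝ S ≤ 1 := by omega
  obtain ⟨e, he⟩ := finrank_le_one_iff.1 hle
  have he' : ∀ y ∈ S, ∃ c : ℝ, c • (e : X) = y := fun y hy => by
    obtain ⟨c, hc⟩ := he ⟨y, hy⟩
    exact ⟨c, by simpa using congrArg Subtype.val hc⟩
  have hu1 : 1 ≤ ‖u‖ := by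
    have := u.le_opNorm p
    rwa [huA.1, hv, hp, mul_one] at this
  rcases hu1.eq_or_lt with h1 | h1
  · have hpS : p ∈ S := by rw [hmem, huA.1, hv, hp, ← h1]; simp
    have hxS : x0 ∈ S := by
      rw [hmem]
      refine le_antisymm (u.le_opNorm _) ?_
      rw [← h1, hx0n]
      have := w.le_opNorm (u x0)
      rw [huA.2, hx0, hw] at this
      linarith
    obtain ⟨c, hc⟩ := he' p hpS
    obtain ⟨c', hc'⟩ := he' x0 hxS
    have hc0 : c ≠ 0 := by rintro rfl; apply hp0; rw [← hc]; simp
    have hqe : q (e : X) = 0 := by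
      have := congrArg q hc
      rw [hqp] at this
      simpa [hc0] using this
    apply hqx0
    rw [← hc']
    simp [hqe]
  · obtain ⟨x, hx1, hxu⟩ := nv_attain u
    have hxS : x ∈ S := by rw [hmem, hxu, hx1, mul_one]
    have hx0' : x ≠ 0 := by rintro rfl; simp at hx1
    have hpS : p ∉ S := by
      rw [hmem, huA.1, hv, hp]; intro h; linarith
    obtain ⟨a, s, has⟩ := nv_decomp hZ v hv0 w hwv z1 hwz1 (u x)
    have hn : ‖u x - s • v‖ ≤ 1 := by
      have h2 : u x - s • v = a • z1 := by rw [has]; simp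
      have h3 : w (u x) = a * w z1 := by rw [has]; simp [hwv]
      rw [h2, norm_smul, hz1n, mul_one]
      have h4 : ‖a‖ = ‖q x‖ := by
        rw [← huA.2, h3, norm_mul, hz1, mul_one]
      rw [h4]
      simpa [hx1, hq] using q.le_opNorm x
    -- functional r with r p = 0, r x = -s
    have hr : ∃ r : X →L[ℝ] ℝ, r p = 0 ∧ r x = -s := by
      have hx : x ∉ Submodule.span ℝ {p} := by
        intro hx
        obtain ⟨c, hc⟩ := Submodule.mem_span_singleton.1 hx
        have hc0 : c ≠ 0 := by rintro rfl; apply hx0'; rw [← hc]; simp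
        apply hpS
        have : p = c⁻¹ • x := by rw [← hc, smul_smul, inv_mul_cancel₀ hc0, one_smul]
        rw [this]
        exact S.smul_mem _ hxS
      obtain ⟨f, hf, hfp⟩ := Submodule.exists_le_ker_of_notMem hx
      have hfp' : f p = 0 := hfp (Submodule.mem_span_singleton_self p)
      refine ⟨(-s / f x) • LinearMap.toContinuousLinearMap f, ?_, ?_⟩
      · simp [hfp']
      · simp [hf]
    obtain ⟨r, hrp, hrx⟩ := hr
    obtain ⟨ε, hε⟩ := nv_perturb u (r.smulRight v) (by
      intro y hy1 hyu
      have hyS : y ∈ S := by rw [hmem, hyu, hy1, mul_one]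
      obtain ⟨c, hc⟩ := he' x hxS
      obtain ⟨c', hc'⟩ := he' y hyS
      have hc0 : c ≠ 0 := by rintro rfl; apply hx0'; rw [← hc]; simp
      have hyx : y = (c' / c) • x := by
        rw [← hc', ← hc, smul_smul, div_mul_cancel₀ _ hc0]
      have hcc : ‖c' / c‖ = 1 := by
        have := congrArg norm hyx
        rw [norm_smul, hx1, hy1] at this
        linarith
      rw [hyx, map_smul, norm_smul, hcc, one_mul]
      have : (u + r.smulRight v) x = u x - s • v := by
        simp [hrx, sub_eq_add_neg]
      rw [this]
      linarith)
    refine absurd (hmin' (u + ε • r.smulRight v) ⟨?_, fun y => ?_⟩) (not_le.2 hε)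
    · simp [hrp, huA.1]
    · simp [hwv, huA.2]

theorem nv_exists_pq {E : Type*} [NormedAddCommGroup E] [NormedSpace ℝ E] [FiniteDimensional ℝ E]
    (h2 : 2 ≤ Module.finrank ℝ E) :
    ∃ p : E, ‖p‖ = 1 ∧ ∃ q : E →L[ℝ] ℝ, ‖q‖ = 1 ∧ q p = 0 := by
  have : Nontrivial E := Module.nontrivial_of_finrank_pos (R := ℝ) (by omega)
  obtain ⟨p, hp⟩ := exists_norm_eq E (zero_le_one : (0 : ℝ) ≤ 1)
  have hlt : Submodule.span ℝ {p} < ⊤ := by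
    refine lt_top_iff_ne_top.2 fun h => ?_
    have h1 := finrank_span_singleton (K := ℝ) (v := p) (by rintro rfl; simp at hp)
    rw [h, finrank_top] at h1
    omega
  obtain ⟨y, -, hy⟩ := SetLike.exists_of_lt hlt
  obtain ⟨f, hf, hfp⟩ := Submodule.exists_le_ker_of_notMem hy
  have hfp' : f p = 0 := hfp (Submodule.mem_span_singleton_self p)
  set g := LinearMap.toContinuousLinearMap f with hg
  have hg0 : ‖g‖ ≠ 0 := by
    rw [norm_ne_zero_iff]
    intro h
    apply hf
    have := congrArg (fun t => t y) h
    simpa [hg] using this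
  exact ⟨p, hp, ‖g‖⁻¹ • g, by simp [norm_smul, hg0], by simp [hg, hfp']⟩

theorem nv_det_neg {Z : Type*} [NormedAddCommGroup Z] [NormedSpace ℝ Z] (p p' : Z)
    (hli : ∀ s t : ℝ, s • p + t • p' = 0 → s = 0 ∧ t = 0)
    (U : Z →L[ℝ] Z) (hU : ∀ z, ‖U z‖ = ‖z‖) (a b c d : ℝ) (h1 : U p = a • p + b • p')
    (h2 : U p' = c • p + d • p') (hdet : a * d - b * c < 0) :
    d = -a ∧ a * a + b * c = 1 := by
  have hroot : ∀ r : ℝ, r * r - (a + d) * r + (a * d - b * c) = 0 → |r| = 1 := by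
    intro r hr
    have key : ∀ s t : ℝ, U (s • p + t • p') = r • (s • p + t • p') → (s ≠ 0 ∨ t ≠ 0) →
        |r| = 1 := by
      intro s t h hst
      have hne : s • p + t • p' ≠ 0 := by
        intro h0
        obtain ⟨hs, ht⟩ := hli s t h0
        tauto
      have h3 := congrArg norm h
      rw [hU, norm_smul, Real.norm_eq_abs] at h3
      have h4 := norm_pos_iff.2 hne
      nlinarith
    by_cases hc : r - d ≠ 0 ∨ b ≠ 0
    · refine key (r - d) b ?_ hc
      rw [map_add, map_smul, map_smul, h1, h2]
      have : r * (r - d) = (r - d) * a + b * c := by linarith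
      rw [smul_add r, smul_smul r, this]
      module
    · push Not at hc
      refine key c (r - a) ?_ ?_
      · rw [map_add, map_smul, map_smul, h1, h2]
        have : r * (r - a) = c * b + (r - a) * d := by linarith
        rw [smul_add r, smul_smul r (r - a), this]
        module
      · right
        intro h
        have hd : d = r := by linarith [hc.1]
        have ha : a = r := by linarith
        rw [hc.2, hd, ha] at hdet
        nlinarith
  set D := Real.sqrt ((a + d) ^ 2 - 4 * (a * d - b * c)) with hD
  have hDs : D * D = (a + d) ^ 2 - 4 * (a * d - b * c) :=
    Real.mul_self_sqrt (by nlinarith [sq_nonneg (a + d)])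
  have hD0 : 0 ≤ D := Real.sqrt_nonneg _
  have hDlt : |a + d| < D := by
    apply abs_lt_of_sq_lt_sq _ hD0
    nlinarith
  obtain ⟨hl, hr⟩ := abs_lt.1 hDlt
  have e1 := hroot ((a + d + D) / 2) (by nlinarith)
  have e2 := hroot ((a + d - D) / 2) (by nlinarith)
  rw [abs_of_pos (by linarith)] at e1
  rw [abs_of_neg (by linarith)] at e2
  have hd : d = -a := by linarith
  have hD2 : D = 2 := by linarith
  refine ⟨hd, ?_⟩
  rw [hD2, hd] at hDs
  nlinarith

theorem nv_trans {Z : Type*} [NormedAddCommGroup Z] [NormedSpace ℝ Z]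
    (hZ : Module.finrank ℝ Z = 2)
    (hN : ∀ u : Z →L[ℝ] Z, ∃ S : Submodule ℝ Z, (S : Set Z) = {x : Z | ‖u x‖ = ‖u‖ * ‖x‖})
    (p : Z) (hp : ‖p‖ = 1) (v : Z) (hv : ‖v‖ = 1) (f : Z →L[ℝ] ℝ) (hf : f ≠ 0)
    (hfp : f p = 0) (g : Z →L[ℝ] ℝ) (hg : g ≠ 0) (hgv : g v = 0) :
    ∃ U : Z →L[ℝ] Z, (∀ z, ‖U z‖ = ‖z‖) ∧ U p = v ∧ ∀ z, ‖f‖ * g (U z) = ‖g‖ * f z := by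
  have : FiniteDimensional ℝ Z := Module.finite_of_finrank_pos (by omega)
  have hf' := norm_ne_zero_iff.2 hf
  have hg' := norm_ne_zero_iff.2 hg
  obtain ⟨u, hup, hu, S, hS, hS2⟩ := nv_main hZ hN p hp v hv (‖f‖⁻¹ • f)
    (by simp [norm_smul, hf']) (by simp [hfp]) (‖g‖⁻¹ • g) (by simp [norm_smul, hg'])
    (by simp [hgv])
  have htop : S = ⊤ := by
    apply Submodule.eq_top_of_finrank_eq
    have := S.finrank_le
    omega
  have hall : ∀ z, ‖u z‖ = ‖u‖ * ‖z‖ := fun z => by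
    have : z ∈ (S : Set Z) := by rw [htop]; trivial
    rw [hS] at this
    exact this
  have hu1 : ‖u‖ = 1 := by
    have := hall p
    rw [hup, hv, hp] at this
    linarith
  refine ⟨u, fun z => by rw [hall, hu1, one_mul], hup, fun z => ?_⟩
  have := hu z
  simp only [smul_apply, smul_eq_mul] at this
  field_simp at this
  linarith

theorem nv_plane {Z : Type*} [NormedAddCommGroup Z] [NormedSpace ℝ Z]
    (hZ : Module.finrank ℝ Z = 2)
    (hN : ∀ u : Z →L[ℝ] Z, ∃ S : Submodule ℝ Z, (S : Set Z) = {x : Z | ‖u x‖ = ‖u‖ * ‖x‖})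
    (x y : Z) : ‖x + y‖ * ‖x + y‖ + ‖x - y‖ * ‖x - y‖ = 2 * (‖x‖ * ‖x‖ + ‖y‖ * ‖y‖) := by
  have : FiniteDimensional ℝ Z := Module.finite_of_finrank_pos (by omega)
  obtain ⟨p, hp, f, hf, hfp⟩ := nv_exists_pq (E := Z) hZ.ge
  have hp0 : p ≠ 0 := by rintro rfl; simp at hp
  have hf0 : f ≠ 0 := by rintro rfl; simp at hf
  obtain ⟨e, he⟩ : ∃ e, f e ≠ 0 := by
    by_contra! h
    exact hf0 (by ext z; simpa using h z)
  obtain ⟨R, hR, hRp, hRf⟩ := nv_trans hZ hN p hp p hp f hf0 hfp (-f) (neg_ne_zero.2 hf0)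
    (by simp [hfp])
  obtain ⟨a, s, has⟩ := nv_decomp hZ p hp0 f hfp e he (R e)
  have ha : a = -1 := by
    have h := hRf e
    rw [has] at h
    simp [hf, hfp] at h
    have : (a + 1) * f e = 0 := by linarith
    rcases mul_eq_zero.1 this with h | h
    · linarith
    · exact absurd h he
  subst ha
  set e' := e - (s / 2) • p with he'
  have hfe' : f e' ≠ 0 := by simpa [he', hfp] using he
  have hRe' : R e' = -e' := by
    rw [he', map_sub, map_smul, has, hRp]; module
  have he'0 : e' ≠ 0 := by intro h; simp [h] at hfe'
  have hn0 : ‖e'‖ ≠ 0 := norm_ne_zero_iff.2 he'0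
  obtain ⟨p', hp', hRp', hfp'⟩ : ∃ p' : Z, ‖p'‖ = 1 ∧ R p' = -p' ∧ f p' ≠ 0 :=
    ⟨‖e'‖⁻¹ • e', by simp [norm_smul, hn0], by simp [hRe'], by simp [hn0, hfe']⟩
  have hp'0 : p' ≠ 0 := by rintro rfl; simp at hp'
  have hli : ∀ s t : ℝ, s • p + t • p' = 0 → s = 0 ∧ t = 0 := by
    intro s t h
    have h1 := congrArg f h
    simp [hfp, hfp'] at h1
    subst h1
    simpa [hp0] using h
  have hdec : ∀ z, ∃ a b : ℝ, z = a • p + b • p' := fun z => by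
    obtain ⟨a, b, h⟩ := nv_decomp hZ p hp0 f hfp p' hfp' z
    exact ⟨b, a, by rw [h, add_comm]⟩
  obtain ⟨β, hβp, hβp'⟩ : ∃ β : Z →L[ℝ] ℝ, β p = 0 ∧ β p' = 1 :=
    ⟨(f p')⁻¹ • f, by simp [hfp], by simp [hfp']⟩
  obtain ⟨α, hαp, hαp'⟩ : ∃ α : Z →L[ℝ] ℝ, α p = 1 ∧ α p' = 0 := by
    have hx : p ∉ Submodule.span ℝ {p'} := by
      intro hx
      obtain ⟨c, hc⟩ := Submodule.mem_span_singleton.1 hx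
      have := (hli 1 (-c) (by rw [← hc]; module)).1
      norm_num at this
    obtain ⟨g, hg, hgp⟩ := Submodule.exists_le_ker_of_notMem hx
    have hgp' : g p' = 0 := hgp (Submodule.mem_span_singleton_self p')
    exact ⟨(g p)⁻¹ • LinearMap.toContinuousLinearMap g, by simp [hg], by simp [hgp']⟩
  have hβ0 : β ≠ 0 := by rintro rfl; simp at hβp'
  have key : ∀ a b : ℝ, ‖a • p + b • p'‖ = 1 → ∃ U : Z →L[ℝ] Z, (∀ z, ‖U z‖ = ‖z‖) ∧
      U p = a • p + b • p' ∧ ∃ c d : ℝ, U p' = c • p + d • p' ∧ a * d - b * c < 0 := by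
    intro a b hab
    have hg0 : b • α - a • β ≠ 0 := by
      intro h
      have h1 := congrArg (fun t => t p) h
      have h2 := congrArg (fun t => t p') h
      simp [hαp, hβp] at h1
      simp [hαp', hβp'] at h2
      simp [h1, h2] at hab
    obtain ⟨U, hU, hUp, hUf⟩ := nv_trans hZ hN p hp _ hab β hβ0 hβp (b • α - a • β) hg0
      (by simp [hαp, hβp, hαp', hβp']; ring)
    obtain ⟨c, d, hcd⟩ := hdec (U p')
    refine ⟨U, hU, hUp, c, d, hcd, ?_⟩
    have h := hUf p'
    rw [hcd] at h
    simp only [sub_apply, smul_apply, map_add, map_smul, hαp, hβp, hαp', hβp', smul_eq_mul,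
      mul_zero, mul_one, zero_add, add_zero] at h
    have h1 := norm_pos_iff.2 hg0
    have h2 := norm_pos_iff.2 hβ0
    have h3 : 0 < b * c - a * d := by
      by_contra! hc
      nlinarith
    linarith
  obtain ⟨Q, hQ, hQp, c0, d0, hQp', hdet0⟩ := key 0 1 (by simpa using hp')
  obtain ⟨hd0, hc0⟩ := nv_det_neg p p' hli Q hQ _ _ _ _ hQp hQp' hdet0
  have hd0' : d0 = 0 := by simpa using hd0
  have hc0' : c0 = 1 := by simpa using hc0
  subst hd0' hc0'
  have hunit : ∀ a b : ℝ, ‖a • p + b • p'‖ = 1 → a * a + b * b = 1 := by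
    intro a b hab
    obtain ⟨U, hU, hUp, c, d, hUp', hdet⟩ := key a b hab
    obtain ⟨h1, h2⟩ := nv_det_neg p p' hli U hU _ _ _ _ hUp hUp' hdet
    obtain ⟨h3, h4⟩ := nv_det_neg p p' hli (U ∘L (Q ∘L R)) (fun z => by simp [hU, hQ, hR])
      c d (-a) (-b) (by simp [hRp, hQp, hUp']) (by simp [hRp', hQp', hUp]; module)
      (by linarith)
    have : b = c := by linarith
    rw [← this] at h2
    exact h2
  have hnorm : ∀ a b : ℝ, ‖a • p + b • p'‖ * ‖a • p + b • p'‖ = a * a + b * b := by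
    intro a b
    by_cases h0 : a • p + b • p' = 0
    · obtain ⟨rfl, rfl⟩ := hli a b h0
      simp
    have hn := norm_ne_zero_iff.2 h0
    set n := ‖a • p + b • p'‖ with hndef
    have h := hunit (n⁻¹ * a) (n⁻¹ * b) (by
      rw [mul_smul, mul_smul, ← smul_add, norm_smul, ← hndef, norm_inv, Real.norm_eq_abs,
        hndef, abs_norm, ← hndef, inv_mul_cancel₀ hn])
    field_simp at h
    nlinarith
  obtain ⟨a, b, rfl⟩ := hdec x
  obtain ⟨c, d, rfl⟩ := hdec y
  have e1 : a • p + b • p' + (c • p + d • p') = (a + c) • p + (b + d) • p' := by module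
  have e2 : a • p + b • p' - (c • p + d • p') = (a - c) • p + (b - d) • p' := by module
  rw [e1, e2, hnorm, hnorm, hnorm, hnorm]
  ring

theorem nv_transfer {X Z : Type*} [NormedAddCommGroup X] [NormedSpace ℝ X]
    [FiniteDimensional ℝ X] [NormedAddCommGroup Z] [NormedSpace ℝ Z]
    (hX : 2 ≤ Module.finrank ℝ X) (hZ : Module.finrank ℝ Z = 2)
    (hN : ∀ u : X →L[ℝ] Z, ∃ S : Submodule ℝ X, (S : Set X) = {x : X | ‖u x‖ = ‖u‖ * ‖x‖})
    (t : Z →L[ℝ] Z) :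
    ∃ S : Submodule ℝ Z, (S : Set Z) = {x : Z | ‖t x‖ = ‖t‖ * ‖x‖} := by
  have : FiniteDimensional ℝ Z := Module.finite_of_finrank_pos (by omega)
  obtain ⟨p, hp, q, hq, hqp⟩ := nv_exists_pq (E := X) hX
  obtain ⟨v, hv, w, hw, hwv⟩ := nv_exists_pq (E := Z) hZ.ge
  obtain ⟨u, hup, -, Y, hY, hY2⟩ := nv_main hZ hN p hp v hv q hq hqp w hw hwv
  have hmem : ∀ x, x ∈ Y ↔ ‖u x‖ = ‖u‖ * ‖x‖ := fun x => by
    rw [← SetLike.mem_coe, hY]; rfl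
  have hu0 : 0 < ‖u‖ := by
    have := u.le_opNorm p
    rw [hup, hv, hp] at this
    linarith
  have hsurj : ∀ z, ∃ y ∈ Y, u y = z := by
    set L : Y →ₗ[ℝ] Z := (u : X →ₗ[ℝ] Z).domRestrict Y with hL
    have hinj : Function.Injective L := by
      rw [← LinearMap.ker_eq_bot, LinearMap.ker_eq_bot']
      rintro ⟨y, hy⟩ h
      have h1 : u y = 0 := h
      have h2 := (hmem y).1 hy
      rw [h1, norm_zero] at h2
      have : y = 0 := by
        rcases mul_eq_zero.1 h2.symm with h | h
        · linarith
        · exact norm_eq_zero.1 h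
      simp [this]
    have hr : LinearMap.range L = ⊤ := by
      apply Submodule.eq_top_of_finrank_eq
      have h1 := LinearMap.finrank_range_of_inj hinj
      have h2 := (LinearMap.range L).finrank_le
      omega
    intro z
    obtain ⟨y, hy⟩ := LinearMap.range_eq_top.1 hr z
    exact ⟨y, y.2, hy⟩
  have hnorm : ‖t ∘L u‖ = ‖t‖ * ‖u‖ := by
    refine le_antisymm (t.opNorm_comp_le u) ?_
    rw [← le_div_iff₀ hu0]
    refine t.opNorm_le_bound (by positivity) fun z => ?_
    obtain ⟨y, hy, rfl⟩ := hsurj z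
    rw [(hmem y).1 hy, ← mul_assoc, div_mul_cancel₀ _ hu0.ne']
    exact (t ∘L u).le_opNorm y
  obtain ⟨S, hS⟩ := hN (t ∘L u)
  have hmemS : ∀ x, x ∈ S ↔ ‖t (u x)‖ = ‖t‖ * ‖u‖ * ‖x‖ := fun x => by
    rw [← SetLike.mem_coe, hS, ← hnorm]; rfl
  refine ⟨(S ⊓ Y).map (u : X →ₗ[ℝ] Z), ?_⟩
  ext z
  constructor
  · rintro ⟨y, ⟨hyS, hyY⟩, rfl⟩
    have h1 := (hmemS y).1 hyS
    have h2 := (hmem y).1 hyY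
    change ‖t (u y)‖ = ‖t‖ * ‖u y‖
    rw [h1, h2, mul_assoc]
  · intro hz
    obtain ⟨y, hy, rfl⟩ := hsurj z
    refine ⟨y, ⟨(hmemS y).2 ?_, hy⟩, rfl⟩
    have hz' : ‖t (u y)‖ = ‖t‖ * ‖u y‖ := hz
    rw [hz', (hmem y).1 hy, mul_assoc]

theorem nv_parallelogram {X : Type*} [NormedAddCommGroup X] [NormedSpace ℝ X]
    [FiniteDimensional ℝ X]
    (hN : ∀ u : X →L[ℝ] X, ∃ S : Submodule ℝ X, (S : Set X) = {x : X | ‖u x‖ = ‖u‖ * ‖x‖})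
    (x y : X) : ‖x + y‖ * ‖x + y‖ + ‖x - y‖ * ‖x - y‖ = 2 * (‖x‖ * ‖x‖ + ‖y‖ * ‖y‖) := by
  by_cases hx0 : x = 0
  · subst hx0; simp; ring
  by_cases hli : LinearIndependent ℝ ![x, y]
  · set Z : Submodule ℝ X := Submodule.span ℝ (Set.range ![x, y]) with hZdef
    have hZ : Module.finrank ℝ Z = 2 := by
      rw [hZdef, finrank_span_eq_card hli]; simp
    have hX : 2 ≤ Module.finrank ℝ X := hZ ▸ Z.finrank_le
    have hN' : ∀ u : X →L[ℝ] Z, ∃ S : Submodule ℝ X,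
        (S : Set X) = {x : X | ‖u x‖ = ‖u‖ * ‖x‖} := by
      intro u
      obtain ⟨S, hS⟩ := hN (Z.subtypeL ∘L u)
      have hn : ‖Z.subtypeL ∘L u‖ = ‖u‖ := by
        apply le_antisymm
        · exact ContinuousLinearMap.opNorm_le_bound _ (norm_nonneg u) fun z => u.le_opNorm z
        · exact ContinuousLinearMap.opNorm_le_bound _ (norm_nonneg (Z.subtypeL ∘L u)) fun z =>
            (Z.subtypeL ∘L u).le_opNorm z
      refine ⟨S, ?_⟩
      rw [hS, hn]
      rfl
    have hx : x ∈ Z := Submodule.subset_span ⟨0, rfl⟩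
    have hy : y ∈ Z := Submodule.subset_span ⟨1, rfl⟩
    exact nv_plane hZ (nv_transfer hX hZ hN') ⟨x, hx⟩ ⟨y, hy⟩
  · rw [LinearIndependent.pair_iff' hx0] at hli
    push Not at hli
    obtain ⟨c, rfl⟩ := hli
    have e1 : x + c • x = (1 + c) • x := by module
    have e2 : x - c • x = (1 - c) • x := by module
    rw [e1, e2, norm_smul, norm_smul, norm_smul]
    simp only [Real.norm_eq_abs]
    have h1 := abs_mul_abs_self (1 + c)
    have h2 := abs_mul_abs_self (1 - c)
    have h3 := abs_mul_abs_self c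
    linear_combination ‖x‖ * ‖x‖ * (h1 + h2 - 2 * h3)

/-- A finite-dimensional real normed space is an inner product space (its norm is
induced by an inner product) if and only if for every linear operator `u : X → X`,
the set of norming vectors `N(u) = {x : ‖u x‖ = ‖u‖_op * ‖x‖}` is a linear subspace. -/
theorem inner_product_space_iff_norming_vectors_subspace_real
    (X : Type*) [NormedAddCommGroup X] [NormedSpace ℝ X] [FiniteDimensional ℝ X] :
    (∃ inn : X → X → ℝ,
        (∀ x y, inn x y = inn y x) ∧
        (∀ x y z, inn (x + y) z = inn x z + inn y z) ∧
        (∀ (a : ℝ) (x y : X), inn (a • x) y = a * inn x y) ∧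
        (∀ x, ‖x‖ ^ 2 = inn x x)) ↔
      (∀ u : X →L[ℝ] X, ∃ S : Submodule ℝ X,
        (S : Set X) = {x : X | ‖u x‖ = ‖u‖ * ‖x‖}) := by
  constructor
  · rintro ⟨inn, hsymm, hadd, hsmul, hnorm⟩ u
    have par : ∀ x y : X, ‖x + y‖ ^ 2 + ‖x - y‖ ^ 2 = 2 * (‖x‖ ^ 2 + ‖y‖ ^ 2) := by
      intro x y
      have e : x - y = x + (-1 : ℝ) • y := by module
      rw [e]
      simp only [hnorm, hadd, hsmul, hsymm _ (x + y), hsymm _ (x + (-1 : ℝ) • y)]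
      ring
    refine ⟨{ carrier := {x : X | ‖u x‖ = ‖u‖ * ‖x‖}, add_mem' := ?_, zero_mem' := by simp,
              smul_mem' := ?_ }, rfl⟩
    · intro x y hx hy
      have hx' : ‖u x‖ = ‖u‖ * ‖x‖ := hx
      have hy' : ‖u y‖ = ‖u‖ * ‖y‖ := hy
      change ‖u (x + y)‖ = ‖u‖ * ‖x + y‖
      have h1 := u.le_opNorm (x + y)
      have h2 := u.le_opNorm (x - y)
      have h3 := par x y
      have h4 := par (u x) (u y)
      rw [← map_add, ← map_sub, hx', hy'] at h4
      have h5 : ‖u (x - y)‖ ^ 2 ≤ (‖u‖ * ‖x - y‖) ^ 2 := by gcongr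
      refine le_antisymm h1 ?_
      refine (sq_le_sq₀ (by positivity) (norm_nonneg _)).1 ?_
      linear_combination h5 - h4 + ‖u‖ ^ 2 * h3
    · intro c x hx
      have hx' : ‖u x‖ = ‖u‖ * ‖x‖ := hx
      change ‖u (c • x)‖ = ‖u‖ * ‖c • x‖
      rw [map_smul, norm_smul, norm_smul, hx']
      ring
  · intro hN
    letI : InnerProductSpace ℝ X := InnerProductSpace.ofNorm ℝ (nv_parallelogram hN)
    exact ⟨fun x y => inner ℝ x y, fun x y => real_inner_comm _ _, fun x y z => inner_add_left _ _ _,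
      fun a x y => real_inner_smul_left _ _ _, fun x => (real_inner_self_eq_norm_sq x).symm⟩
end

section
/- Let X be a finite-dimensional normed space over the complex field. Then the following are equivalent: (1) there exists an inner product ⟨·,·⟩ on X such that ‖x‖² = ⟨x,x⟩ for every x ∈ X; (2) for every linear operator u : X → X, the set N(u) = { x ∈ X : ‖u(x)‖ = ‖u‖_op · ‖x‖ } is a linear subspace of X. -/
lemma nv_max {X : Type*} [NormedAddCommGroup X] [NormedSpace ℂ X] [FiniteDimensional ℂ X]
    (H : ∀ u : X →L[ℂ] X, ∃ S : Submodule ℂ X, (S : Set X) = {x : X | ‖u x‖ = ‖u‖ * ‖x‖})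
    (L : (X →L[ℂ] X) →ₗ[ℂ] ℂ)
    (hL : ∀ S : Submodule ℂ X, S ≠ ⊤ → ∃ w : X →L[ℂ] X, (∀ x ∈ S, w x = 0) ∧ 0 < (L w).re) :
    ∃ g : X →L[ℂ] X, (∀ z, ‖g z‖ = ‖z‖) ∧ ∀ u : X →L[ℂ] X, ‖u‖ ≤ 1 → (L u).re ≤ (L g).re := by
  have : ProperSpace X := FiniteDimensional.proper ℂ X
  have : ProperSpace (X →L[ℂ] X) := FiniteDimensional.proper ℂ _
  have hLc : Continuous L := L.continuous_of_finiteDimensional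
  obtain ⟨u, hu, humax⟩ := (isCompact_closedBall (0 : X →L[ℂ] X) 1).exists_isMaxOn
    ⟨0, by simp⟩ (Complex.continuous_re.comp hLc).continuousOn
  have hu1 : ‖u‖ ≤ 1 := by simpa using hu
  have humax' : ∀ v : X →L[ℂ] X, ‖v‖ ≤ 1 → (L v).re ≤ (L u).re := fun v hv =>
    humax (show v ∈ Metric.closedBall (0 : X →L[ℂ] X) 1 by simpa using hv)
  have hule : ∀ x, ‖u x‖ ≤ ‖x‖ := fun x =>
    (u.le_opNorm x).trans (by nlinarith [norm_nonneg x])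
  obtain ⟨S, hS⟩ : ∃ S : Submodule ℂ X, ∀ x, x ∈ S ↔ ‖u x‖ = ‖x‖ := by
    rcases hu1.lt_or_eq with h | h
    · refine ⟨⊥, fun x => ?_⟩
      rw [Submodule.mem_bot]
      constructor
      · rintro rfl; simp
      · intro hx
        by_contra hne
        have := norm_pos_iff.2 hne
        have := u.le_opNorm x
        nlinarith
    · obtain ⟨S, hS⟩ := H u
      refine ⟨S, fun x => ?_⟩
      rw [← SetLike.mem_coe, hS, h]; simp
  refine ⟨u, fun z => ?_, humax'⟩
  rw [← hS]
  by_cases hT : S = ⊤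
  · simp [hT]
  exfalso
  obtain ⟨w, hw0, hw⟩ := hL S hT
  set a := (L w).re with ha
  set b := (L u).re with hb
  have hb1 : 0 < |b| + 1 := by positivity
  set δ := a / (|b| + 1) with hδ
  have hδ0 : 0 < δ := by positivity
  have hδa : δ * (|b| + 1) = a := by rw [hδ]; field_simp
  have hV : IsCompact (Metric.sphere (0 : X) 1 ∩ {x | δ ≤ ‖w x‖}) :=
    (isCompact_sphere _ _).inter_right (isClosed_le continuous_const (by fun_prop))
  obtain ⟨η, hη, hηV⟩ : ∃ η > 0, ∀ x, ‖x‖ = 1 → δ ≤ ‖w x‖ → ‖u x‖ ≤ 1 - η := by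
    rcases (Metric.sphere (0 : X) 1 ∩ {x | δ ≤ ‖w x‖}).eq_empty_or_nonempty with h | h
    · refine ⟨1, one_pos, fun x hx hx2 => ?_⟩
      exfalso
      have : x ∈ (Metric.sphere (0 : X) 1 ∩ {x | δ ≤ ‖w x‖}) := ⟨by simpa using hx, hx2⟩
      rw [h] at this; exact this
    · obtain ⟨x0, hx0, hm⟩ := hV.exists_isMaxOn h (f := fun x => ‖u x‖) (by fun_prop)
      have hx01 : ‖x0‖ = 1 := by simpa using hx0.1
      refine ⟨1 - ‖u x0‖, ?_, fun x hx hx2 => ?_⟩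
      · have h1 := hule x0
        have h2 : ‖u x0‖ ≠ ‖x0‖ := fun h => by
          have h3 := hw0 x0 ((hS x0).2 h)
          have h4 : δ ≤ ‖w x0‖ := hx0.2
          rw [h3] at h4; simp at h4; linarith
        have := lt_of_le_of_ne h1 h2
        linarith
      · have : ‖u x‖ ≤ ‖u x0‖ := hm (show x ∈ _ from ⟨by simpa using hx, hx2⟩)
        linarith
  obtain ⟨ε, hε, hε1, hε2⟩ : ∃ ε > 0, ε * ‖w‖ ≤ η ∧ ε * δ ≤ 1 := by
    refine ⟨min (η / (‖w‖ + 1)) (1 / δ), by positivity, ?_, ?_⟩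
    · calc _ ≤ η / (‖w‖ + 1) * ‖w‖ := by gcongr; exact min_le_left _ _
        _ ≤ η / (‖w‖ + 1) * (‖w‖ + 1) := by gcongr; linarith
        _ = η := by field_simp
    · calc _ ≤ 1 / δ * δ := by gcongr; exact min_le_right _ _
        _ = 1 := by field_simp
  have hn : ‖((1 - ε * δ : ℝ) : ℂ) • u + ((ε : ℝ) : ℂ) • w‖ ≤ 1 := by
    refine ContinuousLinearMap.opNorm_le_of_unit_norm zero_le_one fun x hx => ?_
    have h1 : ‖(((1 - ε * δ : ℝ) : ℂ) • u + ((ε : ℝ) : ℂ) • w) x‖ ≤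
        (1 - ε * δ) * ‖u x‖ + ε * ‖w x‖ := by
      simp only [ContinuousLinearMap.add_apply, ContinuousLinearMap.smul_apply]
      refine (norm_add_le _ _).trans (le_of_eq ?_)
      rw [norm_smul, norm_smul, Complex.norm_real, Complex.norm_real, Real.norm_of_nonneg hε.le,
        Real.norm_of_nonneg (by linarith)]
    refine h1.trans ?_
    have h2 := hule x
    rw [hx] at h2
    by_cases hc : δ ≤ ‖w x‖
    · have h3 := hηV x hx hc
      have h4 := w.le_opNorm x
      rw [hx, mul_one] at h4
      have h5 : ε * ‖w x‖ ≤ ε * ‖w‖ := by gcongr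
      have h6 : 0 ≤ ε * δ * ‖u x‖ := by positivity
      nlinarith
    · have h5 : ε * ‖w x‖ ≤ ε * δ := by gcongr; exact (not_le.1 hc).le
      nlinarith
  have h := humax' _ hn
  simp only [map_add, map_smul, smul_eq_mul, Complex.add_re, Complex.re_ofReal_mul] at h
  rw [← ha, ← hb] at h
  have h7 : δ * b ≤ δ * |b| := by gcongr; exact le_abs_self b
  have h8 : 0 < ε * (a - δ * b) := by apply mul_pos hε; nlinarith
  nlinarith

lemma nv_approx {X : Type*} [NormedAddCommGroup X] [NormedSpace ℂ X] [FiniteDimensional ℂ X]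
    (H : ∀ u : X →L[ℂ] X, ∃ S : Submodule ℂ X, (S : Set X) = {x : X | ‖u x‖ = ‖u‖ * ‖x‖})
    (φ : X →ₗ[ℂ] ℂ) (x : X) (u₀ : X →L[ℂ] X) (hu₀ : ‖u₀‖ ≤ 1) (δ : ℝ) (hδ : 0 < δ) :
    ∃ g : X →L[ℂ] X, (∀ z, ‖g z‖ = ‖z‖) ∧ (φ (u₀ x)).re - δ ≤ (φ (g x)).re := by
  let T : (X →L[ℂ] X) →ₗ[ℂ] ℂ :=
    (LinearMap.trace ℂ X) ∘ₗ (ContinuousLinearMap.coeLM ℂ)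
  let T' : (X →L[ℂ] X) →L[ℂ] ℂ := LinearMap.toContinuousLinearMap T
  have hT : ∀ u, ‖u‖ ≤ 1 → |(T u).re| ≤ ‖T'‖ := fun u hu => by
    refine (Complex.abs_re_le_norm _).trans ((T'.le_opNorm u).trans ?_)
    nlinarith [norm_nonneg T']
  obtain ⟨ε, hε, hε1, hε2⟩ : ∃ ε > 0, ε * (2 * ‖T'‖) ≤ δ ∧ ((ε : ℝ) : ℂ) ≠ - φ x := by
    set e := δ / (2 * ‖T'‖ + 1) with he
    have he0 : 0 < e := by positivity
    have he1 : e * (2 * ‖T'‖) ≤ δ := by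
      calc _ ≤ e * (2 * ‖T'‖ + 1) := by gcongr; linarith
        _ = δ := by rw [he]; field_simp
    by_cases h : ((e : ℝ) : ℂ) = - φ x
    · refine ⟨e / 2, by positivity, ?_, ?_⟩
      · refine le_trans ?_ he1
        gcongr; linarith
      · rw [← h]; intro h2
        have := Complex.ofReal_injective h2
        linarith
    · exact ⟨e, he0, he1, h⟩
  let L : (X →L[ℂ] X) →ₗ[ℂ] ℂ :=
    φ ∘ₗ (LinearMap.applyₗ x) ∘ₗ (ContinuousLinearMap.coeLM ℂ) + ((ε : ℝ) : ℂ) • T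
  have hLa : ∀ u, L u = φ (u x) + (ε : ℂ) * T u := fun u => rfl
  have hB : Function.Surjective (φ.smulRight x + ((ε : ℝ) : ℂ) • (LinearMap.id : X →ₗ[ℂ] X)) := by
    rw [← LinearMap.injective_iff_surjective, injective_iff_map_eq_zero]
    intro z hz
    simp only [LinearMap.add_apply, LinearMap.smulRight_apply, LinearMap.smul_apply,
      LinearMap.id_apply] at hz
    have h1 := congrArg φ hz
    simp only [map_add, map_smul, smul_eq_mul, map_zero] at h1
    have h2 : φ z * (φ x + ε) = 0 := by linear_combination h1
    have hε0 : (ε : ℂ) ≠ 0 := by exact_mod_cast hε.ne'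
    rcases mul_eq_zero.1 h2 with h | h
    · rw [h, zero_smul, zero_add] at hz
      exact (smul_eq_zero.1 hz).resolve_left hε0
    · exact absurd (by linear_combination h) hε2
  obtain ⟨g, hg, hgm⟩ := nv_max H L (by
    intro S hS
    obtain ⟨f, hf, hfS⟩ := Submodule.exists_le_ker_of_lt_top S (lt_top_iff_ne_top.2 hS)
    obtain ⟨v, hv⟩ : ∃ v, f v ≠ 0 := by
      by_contra! h; exact hf (LinearMap.ext h)
    obtain ⟨z, hz⟩ := hB ((f v)⁻¹ • v)
    refine ⟨LinearMap.toContinuousLinearMap (f.smulRight z), fun s hs => ?_, ?_⟩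
    · have : f s = 0 := hfS hs
      simp [this]
    · have h1 : T (LinearMap.toContinuousLinearMap (f.smulRight z)) = f z := by
        show LinearMap.trace ℂ X (f.smulRight z) = f z
        simp
      have h2 := congrArg f hz
      simp only [LinearMap.add_apply, LinearMap.smulRight_apply, LinearMap.smul_apply,
        LinearMap.id_apply, map_add, map_smul, smul_eq_mul] at h2
      rw [inv_mul_cancel₀ hv] at h2
      have : L (LinearMap.toContinuousLinearMap (f.smulRight z)) = 1 := by
        rw [hLa, h1]
        simp only [LinearMap.coe_toContinuousLinearMap', LinearMap.smulRight_apply, map_smul,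
          smul_eq_mul]
        linear_combination h2
      rw [this]; simp)
  refine ⟨g, hg, ?_⟩
  have h := hgm u₀ hu₀
  rw [hLa, hLa, Complex.add_re, Complex.add_re, Complex.re_ofReal_mul, Complex.re_ofReal_mul] at h
  have hg1 : ‖g‖ ≤ 1 := g.opNorm_le_bound zero_le_one (fun z => by rw [hg, one_mul])
  have h1 := abs_le.1 (hT u₀ hu₀)
  have h2 := abs_le.1 (hT g hg1)
  nlinarith


structure NVForm {X : Type*} [NormedAddCommGroup X] [NormedSpace ℂ X] (h : X → X → ℂ) : Prop where
  symm : ∀ x y, h x y = (starRingEnd ℂ) (h y x)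
  add : ∀ x y z, h (x + y) z = h x z + h y z
  smul : ∀ (a : ℂ) (x y : X), h (a • x) y = a * h x y
  nonneg : ∀ x, 0 ≤ (h x x).re
  bound : ∀ x y, ‖h x y‖ ≤ ‖x‖ * ‖y‖

lemma NVForm.add_right {X : Type*} [NormedAddCommGroup X] [NormedSpace ℂ X] {h : X → X → ℂ}
    (hh : NVForm h) (x y z : X) : h x (y + z) = h x y + h x z := by
  rw [hh.symm, hh.add, map_add, ← hh.symm, ← hh.symm]

lemma NVForm.smul_right {X : Type*} [NormedAddCommGroup X] [NormedSpace ℂ X] {h : X → X → ℂ}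
    (hh : NVForm h) (a : ℂ) (x y : X) : h x (a • y) = (starRingEnd ℂ) a * h x y := by
  rw [hh.symm, hh.smul, map_mul, ← hh.symm]

lemma NVForm.sub_self {X : Type*} [NormedAddCommGroup X] [NormedSpace ℂ X] {h : X → X → ℂ}
    (hh : NVForm h) (x y : X) : (h (x - y) (x - y)).re = (h x x).re - 2 * (h x y).re + (h y y).re := by
  have e : x - y = x + (-1 : ℂ) • y := by simp [sub_eq_add_neg]
  have e2 : (h y x).re = (h x y).re := by rw [hh.symm y x, Complex.conj_re]
  rw [e]
  simp only [hh.add, hh.add_right, hh.smul, hh.smul_right]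
  simp [e2]
  ring

lemma NVForm.continuous {X : Type*} [NormedAddCommGroup X] [NormedSpace ℂ X] {h : X → X → ℂ}
    (hh : NVForm h) : Continuous (fun x => (h x x).re) := by
  rw [continuous_iff_continuousAt]
  intro y
  have hb : ∀ x, |(h x x).re - (h y y).re| ≤ ‖x - y‖ * ‖x‖ + ‖y‖ * ‖x - y‖ := fun x => by
    have e : h x x - h y y = h (x - y) x + h y (x - y) := by
      have h1 := hh.add (x - y) y x
      have h2 := hh.add_right y (x - y) y
      rw [sub_add_cancel] at h1 h2
      rw [h1, h2]; ring
    rw [← Complex.sub_re, e]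
    exact (Complex.abs_re_le_norm _).trans ((norm_add_le _ _).trans
      (add_le_add (hh.bound _ _) (hh.bound _ _)))
  have ht : Filter.Tendsto (fun x => ‖x - y‖ * ‖x‖ + ‖y‖ * ‖x - y‖) (nhds y) (nhds 0) := by
    have : Continuous (fun x => ‖x - y‖ * ‖x‖ + ‖y‖ * ‖x - y‖) := by fun_prop
    simpa using this.tendsto y
  rw [ContinuousAt, tendsto_iff_dist_tendsto_zero]
  exact squeeze_zero (fun _ => dist_nonneg) hb ht

lemma NVForm.comp {X : Type*} [NormedAddCommGroup X] [NormedSpace ℂ X] {h : X → X → ℂ}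
    (hh : NVForm h) (g : X →L[ℂ] X) (hg : ∀ z, ‖g z‖ = ‖z‖) :
    NVForm (fun x y => h (g x) (g y)) where
  symm x y := hh.symm _ _
  add x y z := by simp only [map_add, hh.add]
  smul a x y := by simp only [map_smul, hh.smul]
  nonneg x := hh.nonneg _
  bound x y := by simpa only [hg] using hh.bound (g x) (g y)

lemma NVForm.avg {X ι : Type*} [NormedAddCommGroup X] [NormedSpace ℂ X] {h : ι → X → X → ℂ}
    (F : Finset ι) (hF : F.Nonempty)
    (hh : ∀ i ∈ F, NVForm (h i)) :
    NVForm (fun x y => (((F.card : ℝ)⁻¹ : ℝ) : ℂ) * ∑ i ∈ F, h i x y) where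
  symm x y := by
    rw [map_mul, Complex.conj_ofReal, map_sum]
    congr 1
    exact Finset.sum_congr rfl fun i hi => (hh i hi).symm _ _
  add x y z := by
    rw [← mul_add, ← Finset.sum_add_distrib]
    congr 1
    exact Finset.sum_congr rfl fun i hi => (hh i hi).add _ _ _
  smul a x y := by
    rw [mul_left_comm, Finset.mul_sum F _ a]
    congr 1
    exact Finset.sum_congr rfl fun i hi => (hh i hi).smul _ _ _
  nonneg x := by
    rw [Complex.re_ofReal_mul, Complex.re_sum]
    exact mul_nonneg (by positivity) (Finset.sum_nonneg fun i hi => (hh i hi).nonneg x)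
  bound x y := by
    have hc : (0 : ℝ) < F.card := by exact_mod_cast hF.card_pos
    rw [norm_mul, Complex.norm_real, Real.norm_of_nonneg (by positivity), inv_mul_le_iff₀ hc]
    refine (norm_sum_le _ _).trans ?_
    refine (Finset.sum_le_sum fun i hi => (hh i hi).bound x y).trans ?_
    simp

lemma nv_compact (X : Type*) [NormedAddCommGroup X] [NormedSpace ℂ X] :
    IsCompact {p : (X → X → ℂ) × ℝ | NVForm p.1 ∧ p.2 ∈ Set.Icc (0 : ℝ) 1 ∧
      ∀ x, p.2 * ‖x‖ ^ 2 ≤ (p.1 x x).re} := by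
  have hK : IsCompact ((Set.univ.pi fun x : X => Set.univ.pi fun y : X =>
      Metric.closedBall (0 : ℂ) (‖x‖ * ‖y‖)) ×ˢ Set.Icc (0 : ℝ) 1) :=
    (isCompact_univ_pi fun x => isCompact_univ_pi fun y => isCompact_closedBall _ _).prod
      isCompact_Icc
  refine hK.of_isClosed_subset ?_ ?_
  · have : {p : (X → X → ℂ) × ℝ | NVForm p.1 ∧ p.2 ∈ Set.Icc (0 : ℝ) 1 ∧
      ∀ x, p.2 * ‖x‖ ^ 2 ≤ (p.1 x x).re} =
      {p | ∀ x y, p.1 x y = (starRingEnd ℂ) (p.1 y x)} ∩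
      {p | ∀ x y z, p.1 (x + y) z = p.1 x z + p.1 y z} ∩
      {p | ∀ (a : ℂ) (x y : X), p.1 (a • x) y = a * p.1 x y} ∩
      {p | ∀ x, 0 ≤ (p.1 x x).re} ∩
      {p | ∀ x y, ‖p.1 x y‖ ≤ ‖x‖ * ‖y‖} ∩ {p | 0 ≤ p.2} ∩ {p | p.2 ≤ 1} ∩
      {p | ∀ x, p.2 * ‖x‖ ^ 2 ≤ (p.1 x x).re} := by
      ext p
      constructor
      · rintro ⟨⟨a, b, c, d, e⟩, ⟨f, g⟩, i⟩
        exact ⟨⟨⟨⟨⟨⟨⟨a, b⟩, c⟩, d⟩, e⟩, f⟩, g⟩, i⟩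
      · rintro ⟨⟨⟨⟨⟨⟨⟨a, b⟩, c⟩, d⟩, e⟩, f⟩, g⟩, i⟩
        exact ⟨⟨a, b, c, d, e⟩, ⟨f, g⟩, i⟩
    have hc : ∀ x y : X, Continuous (fun p : (X → X → ℂ) × ℝ => p.1 x y) := fun x y => by fun_prop
    have hr : ∀ x y : X, Continuous (fun p : (X → X → ℂ) × ℝ => (p.1 x y).re) := fun x y =>
      Complex.continuous_re.comp (hc x y)
    rw [this]
    simp only [Set.ofPred_forall]
    refine ((((((IsClosed.inter ?_ ?_).inter ?_).inter ?_).inter ?_).inter ?_).inter ?_).inter ?_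
    · exact isClosed_iInter fun x => isClosed_iInter fun y =>
        isClosed_eq (hc x y) (Complex.continuous_conj.comp (hc y x))
    · exact isClosed_iInter fun x => isClosed_iInter fun y => isClosed_iInter fun z =>
        isClosed_eq (hc _ _) ((hc _ _).add (hc _ _))
    · exact isClosed_iInter fun a => isClosed_iInter fun x => isClosed_iInter fun y =>
        isClosed_eq (hc _ _) (continuous_const.mul (hc _ _))
    · exact isClosed_iInter fun x => isClosed_le continuous_const (hr _ _)
    · exact isClosed_iInter fun x => isClosed_iInter fun y =>
        isClosed_le (hc _ _).norm continuous_const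
    · exact isClosed_le continuous_const continuous_snd
    · exact isClosed_le continuous_snd continuous_const
    · exact isClosed_iInter fun x => isClosed_le (continuous_snd.mul continuous_const) (hr _ _)
  · rintro p ⟨h, ht, -⟩
    refine ⟨fun x _ y _ => ?_, ht⟩
    simpa using h.bound x y

lemma nv_exists_pos (X : Type*) [NormedAddCommGroup X] [NormedSpace ℂ X] [FiniteDimensional ℂ X] :
    ∃ (h : X → X → ℂ) (t : ℝ), 0 < t ∧ t ≤ 1 ∧ NVForm h ∧ ∀ x, t * ‖x‖ ^ 2 ≤ (h x x).re := by
  let e : X ≃L[ℂ] EuclideanSpace ℂ (Fin (Module.finrank ℂ X)) :=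
    ContinuousLinearEquiv.ofFinrankEq (by simp)
  let A : X →L[ℂ] EuclideanSpace ℂ (Fin (Module.finrank ℂ X)) := e
  let B : EuclideanSpace ℂ (Fin (Module.finrank ℂ X)) →L[ℂ] X := e.symm
  have hA : ∀ x, ‖A x‖ ≤ (‖A‖ + 1) * ‖x‖ := fun x =>
    (A.le_opNorm x).trans (by nlinarith [norm_nonneg x])
  have hB : ∀ x, ‖x‖ ≤ (‖B‖ + 1) * ‖A x‖ := fun x => by
    have := B.le_opNorm (A x)
    have h2 : B (A x) = x := e.symm_apply_apply x
    rw [h2] at this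
    nlinarith [norm_nonneg (A x)]
  have ha : 1 ≤ ‖A‖ + 1 := by linarith [norm_nonneg A]
  have hb : 1 ≤ ‖B‖ + 1 := by linarith [norm_nonneg B]
  generalize ‖A‖ + 1 = a at *
  generalize ‖B‖ + 1 = b at *
  have hself : ∀ x, ((((a ^ 2)⁻¹ : ℝ) : ℂ) * inner ℂ (A x) (A x)).re = (a ^ 2)⁻¹ * ‖A x‖ ^ 2 := by
    intro x
    rw [Complex.re_ofReal_mul]
    congr 1
    exact inner_self_eq_norm_sq (𝕜 := ℂ) (A x)
  refine ⟨fun x y => (((a ^ 2)⁻¹ : ℝ) : ℂ) * inner ℂ (A y) (A x), (a ^ 2)⁻¹ * (b ^ 2)⁻¹,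
    by positivity, ?_, ⟨?_, ?_, ?_, ?_, ?_⟩, ?_⟩
  · exact mul_le_one₀ (inv_le_one_of_one_le₀ (one_le_pow₀ ha)) (by positivity)
      (inv_le_one_of_one_le₀ (one_le_pow₀ hb))
  · intro x y
    rw [map_mul, Complex.conj_ofReal, inner_conj_symm]
  · intro x y z
    rw [map_add, inner_add_right, mul_add]
  · intro c x y
    rw [map_smul, inner_smul_right]; ring
  · intro x
    rw [hself]; positivity
  · intro x y
    rw [norm_mul, Complex.norm_real, Real.norm_of_nonneg (by positivity),
      inv_mul_le_iff₀ (by positivity)]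
    refine (norm_inner_le_norm _ _).trans ?_
    calc _ ≤ (a * ‖y‖) * (a * ‖x‖) := mul_le_mul (hA y) (hA x) (by positivity) (by positivity)
      _ = _ := by ring
  · intro x
    rw [hself, mul_assoc]
    gcongr
    rw [inv_mul_le_iff₀ (by positivity), ← mul_pow]
    gcongr
    exact hB x

lemma nv_backward (X : Type*) [NormedAddCommGroup X] [NormedSpace ℂ X] [FiniteDimensional ℂ X]
    (H : ∀ u : X →L[ℂ] X, ∃ S : Submodule ℂ X, (S : Set X) = {x : X | ‖u x‖ = ‖u‖ * ‖x‖}) :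
    ∃ (h : X → X → ℂ) (t : ℝ), 0 < t ∧ NVForm h ∧ ∀ x, (h x x).re = t * ‖x‖ ^ 2 := by
  have : ProperSpace X := FiniteDimensional.proper ℂ X
  obtain ⟨h0, t0, ht0, ht1, hh0, hl0⟩ := nv_exists_pos X
  obtain ⟨⟨h, t⟩, ⟨hh, htI, hl⟩, hmax⟩ := (nv_compact X).exists_isMaxOn
    ⟨(h0, t0), hh0, ⟨ht0.le, ht1⟩, hl0⟩ continuous_snd.continuousOn
  have hmax' : ∀ (h' : X → X → ℂ) (t' : ℝ), NVForm h' → t' ∈ Set.Icc (0 : ℝ) 1 →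
      (∀ x, t' * ‖x‖ ^ 2 ≤ (h' x x).re) → t' ≤ t := fun h' t' a b c =>
    hmax (show (h', t') ∈ _ from ⟨a, b, c⟩)
  simp only at hh htI hl
  have htpos : 0 < t := lt_of_lt_of_le ht0 (hmax' h0 t0 hh0 ⟨ht0.le, ht1⟩ hl0)
  refine ⟨h, t, htpos, hh, ?_⟩
  -- homogeneity of the diagonal
  have hom : ∀ (k : X → X → ℂ), NVForm k → ∀ x : X, x ≠ 0 →
      (k x x).re = ‖x‖ ^ 2 *
        (k (((‖x‖⁻¹ : ℝ) : ℂ) • x) (((‖x‖⁻¹ : ℝ) : ℂ) • x)).re := by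
    intro k hk x hx
    have hx' := norm_pos_iff.2 hx
    rw [hk.smul, hk.smul_right, Complex.conj_ofReal, Complex.re_ofReal_mul, Complex.re_ofReal_mul]
    field_simp
  have hunit : ∀ x : X, x ≠ 0 → ‖((‖x‖⁻¹ : ℝ) : ℂ) • x‖ = 1 := by
    intro x hx
    have hx' := norm_pos_iff.2 hx
    rw [norm_smul, Complex.norm_real, Real.norm_of_nonneg (by positivity)]
    field_simp
  suffices hs : ∀ y, ‖y‖ = 1 → (h y y).re ≤ t by
    intro x
    refine le_antisymm ?_ (hl x)
    by_cases hx : x = 0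
    · have := hh.bound x x
      have h2 := Complex.re_le_norm (h x x)
      rw [hx] at *
      simp at this ⊢
      simp [this]
    · rw [hom h hh x hx, mul_comm]
      gcongr
      exact hs _ (hunit x hx)
  intro y hy
  by_contra! hlt
  -- every unit vector can be moved to a better one
  have key : ∀ x : X, ‖x‖ = 1 → ∃ g : X →L[ℂ] X, (∀ z, ‖g z‖ = ‖z‖) ∧ t < (h (g x) (g x)).re := by
    intro x hx
    obtain ⟨f, hf, hfx⟩ := exists_dual_vector ℂ x (by intro h0; simp [h0] at hx)
    let φ : X →ₗ[ℂ] ℂ :=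
      { toFun := fun z => h z y
        map_add' := fun a b => hh.add a b y
        map_smul' := fun a b => hh.smul a b y }
    obtain ⟨g, hg, hgx⟩ := nv_approx H φ x (f.smulRight y) (by
      rw [ContinuousLinearMap.norm_smulRight_apply, hf, hy, mul_one]) (((h y y).re - t) / 4)
      (by linarith)
    refine ⟨g, hg, ?_⟩
    have e : (f.smulRight y) x = y := by
      rw [ContinuousLinearMap.smulRight_apply, hfx, hx]; simp
    rw [e] at hgx
    have h1 : (h y y).re - ((h y y).re - t) / 4 ≤ (h (g x) y).re := hgx
    have h2 := hh.nonneg (g x - y)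
    rw [hh.sub_self] at h2
    linarith
  let I := {g : X →L[ℂ] X // ∀ z, ‖g z‖ = ‖z‖}
  obtain ⟨F, hF⟩ := (isCompact_sphere (0 : X) 1).elim_finite_subcover
    (fun g : I => {x : X | t < (h (g.1 x) (g.1 x)).re})
    (fun g => isOpen_lt continuous_const (hh.comp g.1 g.2).continuous)
    (fun x hx => by
      obtain ⟨g, hg, hgx⟩ := key x (by simpa using hx)
      exact Set.mem_iUnion.2 ⟨⟨g, hg⟩, hgx⟩)
  have hF' : ∀ x : X, ‖x‖ = 1 → ∃ g ∈ F, t < (h (g.1 x) (g.1 x)).re := by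
    intro x hx
    have := hF (show x ∈ Metric.sphere (0 : X) 1 by simpa using hx)
    simpa using this
  have hFn : F.Nonempty := by
    obtain ⟨g, hg, -⟩ := hF' y hy
    exact ⟨g, hg⟩
  have hk := NVForm.avg (h := fun (g : I) x y => h (g.1 x) (g.1 y)) F hFn
    (fun g _ => hh.comp g.1 g.2)
  set k : X → X → ℂ := fun x y => (((F.card : ℝ)⁻¹ : ℝ) : ℂ) * ∑ g ∈ F, h (g.1 x) (g.1 y) with hkdef
  have hkt : ∀ x, ‖x‖ = 1 → t < (k x x).re := by
    intro x hx
    have hc : (0 : ℝ) < F.card := by exact_mod_cast hFn.card_pos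
    simp only [hkdef]
    rw [Complex.re_ofReal_mul, Complex.re_sum, lt_inv_mul_iff₀ hc]
    have : ∑ g ∈ F, t < ∑ g ∈ F, (h (g.1 x) (g.1 x)).re := by
      refine Finset.sum_lt_sum (fun g _ => ?_) (hF' x hx)
      have := hl (g.1 x)
      rwa [g.2, hx, one_pow, mul_one] at this
    simpa using this
  obtain ⟨x0, hx0, hmin⟩ := (isCompact_sphere (0 : X) 1).exists_isMinOn ⟨y, by simpa using hy⟩
    hk.continuous.continuousOn
  have hx01 : ‖x0‖ = 1 := by simpa using hx0
  have hlt0 := hkt x0 hx01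
  have : (k x0 x0).re ≤ t := by
    refine hmax' k _ hk ⟨hk.nonneg _, ?_⟩ ?_
    · have := hk.bound x0 x0
      rw [hx01, one_mul] at this
      exact (Complex.re_le_norm _).trans this
    · intro x
      by_cases hx : x = 0
      · simpa [hx] using hk.nonneg 0
      · rw [hom k hk x hx, mul_comm]
        have hm := isMinOn_iff.1 hmin _ (mem_sphere_zero_iff_norm.2 (hunit x hx))
        nlinarith [mul_le_mul_of_nonneg_right hm (sq_nonneg ‖x‖)]
  linarith

/-- A finite-dimensional complex normed space is an inner product space (its norm is
induced by an inner product) if and only if for every linear operator `u : X → X`,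
the set of norming vectors `N(u) = {x : ‖u x‖ = ‖u‖_op * ‖x‖}` is a linear subspace. -/
theorem inner_product_space_iff_norming_vectors_subspace_complex
    (X : Type*) [NormedAddCommGroup X] [NormedSpace ℂ X] [FiniteDimensional ℂ X] :
    (∃ inn : X → X → ℂ,
        (∀ x y, inn x y = (starRingEnd ℂ) (inn y x)) ∧
        (∀ x y z, inn (x + y) z = inn x z + inn y z) ∧
        (∀ (a : ℂ) (x y : X), inn (a • x) y = a * inn x y) ∧
        (∀ x, ((‖x‖ : ℂ)) ^ 2 = inn x x)) ↔
      (∀ u : X →L[ℂ] X, ∃ S : Submodule ℂ X,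
        (S : Set X) = {x : X | ‖u x‖ = ‖u‖ * ‖x‖}) := by
  constructor
  · rintro ⟨inn, hs, ha, hm, hn⟩ u
    have har : ∀ x y z, inn x (y + z) = inn x y + inn x z := fun x y z => by
      rw [hs, ha, map_add, ← hs, ← hs]
    have hmr : ∀ (a : ℂ) (x y : X), inn x (a • y) = (starRingEnd ℂ) a * inn x y := fun a x y => by
      rw [hs, hm, map_mul, ← hs]
    have par : ∀ x y : X, ‖x + y‖ ^ 2 + ‖x - y‖ ^ 2 = 2 * (‖x‖ ^ 2 + ‖y‖ ^ 2) := by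
      intro x y
      have e : x - y = x + (-1 : ℂ) • y := by simp [sub_eq_add_neg]
      have : ((‖x + y‖ : ℂ)) ^ 2 + (‖x - y‖ : ℂ) ^ 2 = 2 * ((‖x‖ : ℂ) ^ 2 + (‖y‖ : ℂ) ^ 2) := by
        rw [hn, hn, hn, hn, e]
        simp only [ha, har, hm, hmr]
        simp
        ring
      exact_mod_cast this
    refine ⟨{ carrier := {x : X | ‖u x‖ = ‖u‖ * ‖x‖}, zero_mem' := by simp, add_mem' := ?_,
              smul_mem' := ?_ }, rfl⟩
    · intro x y hx hy
      simp only [Set.mem_ofPred_eq] at *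
      have p1 := par x y
      have p2 := par (u x) (u y)
      rw [← map_add, ← map_sub, hx, hy] at p2
      have l1 := u.le_opNorm (x + y)
      have l2 := pow_le_pow_left₀ (norm_nonneg _) (u.le_opNorm (x - y)) 2
      refine le_antisymm l1 (le_of_sq_le_sq ?_ (norm_nonneg _))
      rw [mul_pow] at *
      nlinarith
    · intro c x hx
      simp only [Set.mem_ofPred_eq] at *
      rw [map_smul, norm_smul, norm_smul, hx]; ring
  · intro H
    obtain ⟨h, t, ht, hh, hx⟩ := nv_backward X H
    refine ⟨fun x y => ((t⁻¹ : ℝ) : ℂ) * h x y, fun x y => ?_, fun x y z => ?_, fun a x y => ?_,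
      fun x => ?_⟩
    · rw [map_mul, Complex.conj_ofReal, ← hh.symm]
    · beta_reduce
      rw [hh.add, mul_add]
    · beta_reduce
      rw [hh.smul]; ring
    · have : h x x = (((h x x).re : ℝ) : ℂ) := (Complex.conj_eq_iff_re.1 (hh.symm x x).symm).symm
      beta_reduce
      rw [this, hx]
      have ht' : (t : ℂ) ≠ 0 := by exact_mod_cast ht.ne'
      push_cast
      field_simp
end

section
/- Let X be a finite-dimensional inner product space over the real or complex field and let u : X → X be a linear operator. Then the set of norming vectors N(u) = { x ∈ X : ‖u(x)‖ = ‖u‖_op · ‖x‖ } is a linear subspace of X. -/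
/-- In a finite-dimensional inner product space over ℝ or ℂ, the set of norming
vectors of any linear operator is a linear subspace. -/
theorem norming_vectors_subspace_of_innerProductSpace
    {𝕜 : Type*} [RCLike 𝕜] {X : Type*} [NormedAddCommGroup X]
    [InnerProductSpace 𝕜 X] [FiniteDimensional 𝕜 X] (u : X →L[𝕜] X) :
    ∃ S : Submodule 𝕜 X, (S : Set X) = {x : X | ‖u x‖ = ‖u‖ * ‖x‖} := by
  refine ⟨{ carrier := {x : X | ‖u x‖ = ‖u‖ * ‖x‖}, add_mem' := ?_, zero_mem' := by simp,
            smul_mem' := ?_ }, rfl⟩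
  · intro x y hx hy
    simp only [Set.mem_setOf_eq] at hx hy ⊢
    have h1 := parallelogram_law_with_norm 𝕜 x y
    have h2 := parallelogram_law_with_norm 𝕜 (u x) (u y)
    rw [← map_add, ← map_sub, hx, hy] at h2
    have h3 := u.le_opNorm (x + y)
    have h4 := u.le_opNorm (x - y)
    have h5 := mul_self_le_mul_self (norm_nonneg _) h4
    refine le_antisymm h3 (abs_le_of_sq_le_sq' ?_ (norm_nonneg _)).2
    linear_combination h5 - h2 + ‖u‖ ^ 2 * h1
  · intro c x hx
    simp only [Set.mem_setOf_eq] at hx ⊢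
    rw [map_smul, norm_smul, norm_smul, hx]
    ring
end

section
/- Let X be a nonzero finite-dimensional inner product space over the real or complex field and let u : X → X be a linear operator. Then the set of norming vectors N(u) = { x ∈ X : ‖u(x)‖ = ‖u‖_op · ‖x‖ } coincides with the eigenspace of the self-adjoint operator u*u associated with its largest eigenvalue λ_max(u*u), and moreover λ_max(u*u) = ‖u‖_op². -/
open ContinuousLinearMap in
lemma aux_norm_sq {𝕜 : Type*} [RCLike 𝕜] {X : Type*} [NormedAddCommGroup X]
    [InnerProductSpace 𝕜 X] [CompleteSpace X] (u : X →L[𝕜] X) (x : X) (c : ℝ)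
    (h : adjoint u (u x) = (c : 𝕜) • x) : ‖u x‖ ^ 2 = c * ‖x‖ ^ 2 := by
  have h1 : inner 𝕜 x (adjoint u (u x)) = ((‖u x‖ ^ 2 : ℝ) : 𝕜) := by
    rw [adjoint_inner_right, inner_self_eq_norm_sq_to_K]; push_cast; rfl
  rw [h, inner_smul_right, inner_self_eq_norm_sq_to_K] at h1
  exact_mod_cast h1.symm

open ContinuousLinearMap in
lemma aux_iff {𝕜 : Type*} [RCLike 𝕜] {X : Type*} [NormedAddCommGroup X]
    [InnerProductSpace 𝕜 X] [CompleteSpace X] (u : X →L[𝕜] X) (x : X) :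
    ‖u x‖ = ‖u‖ * ‖x‖ ↔ adjoint u (u x) = ((‖u‖ ^ 2 : ℝ) : 𝕜) • x := by
  constructor
  · intro h
    rw [← sub_eq_zero, ← norm_eq_zero, ← sq_eq_zero_iff]
    refine le_antisymm ?_ (sq_nonneg _)
    have h1 : RCLike.re (inner 𝕜 (adjoint u (u x)) (((‖u‖ ^ 2 : ℝ) : 𝕜) • x))
        = ‖u‖ ^ 2 * ‖u x‖ ^ 2 := by
      rw [inner_smul_right, adjoint_inner_left, RCLike.re_ofReal_mul, inner_self_eq_norm_sq]
    have h2 : ‖adjoint u (u x)‖ ≤ ‖u‖ * ‖u x‖ := by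
      have := (adjoint u).le_opNorm (u x)
      rwa [LinearIsometryEquiv.norm_map] at this
    have h3 : ‖adjoint u (u x)‖ ^ 2 ≤ (‖u‖ * ‖u x‖) ^ 2 :=
      pow_le_pow_left₀ (norm_nonneg _) h2 2
    rw [norm_sub_sq (𝕜 := 𝕜), h1, norm_smul, RCLike.norm_ofReal, abs_of_nonneg (sq_nonneg _)]
    rw [h] at h3 ⊢
    nlinarith
  · intro h
    have := aux_norm_sq u x _ h
    rw [← mul_pow] at this
    exact (pow_left_inj₀ (norm_nonneg _) (by positivity) two_ne_zero).1 this

lemma aux_exists {𝕜 : Type*} [RCLike 𝕜] {X : Type*} [NormedAddCommGroup X]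
    [InnerProductSpace 𝕜 X] [FiniteDimensional 𝕜 X] [Nontrivial X] (u : X →L[𝕜] X) :
    ∃ x : X, x ≠ 0 ∧ ‖u x‖ = ‖u‖ * ‖x‖ := by
  haveI : ProperSpace X := FiniteDimensional.proper_rclike 𝕜 X
  have hn : ∀ y : X, y ≠ 0 → ‖((‖y‖⁻¹ : ℝ) : 𝕜) • y‖ = 1 := by
    intro y hy
    have := norm_ne_zero_iff.2 hy
    rw [norm_smul, RCLike.norm_ofReal, abs_of_nonneg (by positivity), inv_mul_cancel₀ this]
  obtain ⟨z, hz⟩ := exists_ne (0 : X)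
  obtain ⟨x, hx, hmax⟩ := (isCompact_sphere (0 : X) 1).exists_isMaxOn
    ⟨((‖z‖⁻¹ : ℝ) : 𝕜) • z, by simpa using hn z hz⟩
    (f := fun y => ‖u y‖) (by fun_prop)
  have hx1 : ‖x‖ = 1 := by simpa using hx
  refine ⟨x, norm_ne_zero_iff.1 (by simp [hx1]), le_antisymm (u.le_opNorm x) ?_⟩
  rw [hx1, mul_one]
  refine u.opNorm_le_bound (norm_nonneg _) fun y => ?_
  by_cases hy : y = 0
  · simp [hy]
  have h0 : 0 < ‖y‖ := norm_pos_iff.2 hy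
  have h1 : ‖u (((‖y‖⁻¹ : ℝ) : 𝕜) • y)‖ ≤ ‖u x‖ :=
    hmax (show _ ∈ Metric.sphere (0 : X) 1 from mem_sphere_zero_iff_norm.2 (hn y hy))
  rw [map_smul, norm_smul, RCLike.norm_ofReal, abs_of_nonneg (by positivity),
    inv_mul_le_iff₀ h0] at h1
  linarith

open ContinuousLinearMap in
/-- In a nonzero finite-dimensional inner product space over ℝ or ℂ, for any linear
operator `u`, the self-adjoint operator `u* u` has a largest eigenvalue `λ`, it
equals `‖u‖_op ^ 2`, and the set of norming vectors of `u` coincides with the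
eigenspace of `u* u` associated with `λ`. -/
theorem norming_vectors_eq_top_eigenspace
    {𝕜 : Type*} [RCLike 𝕜] {X : Type*} [NormedAddCommGroup X]
    [InnerProductSpace 𝕜 X] [FiniteDimensional 𝕜 X] [CompleteSpace X] [Nontrivial X]
    (u : X →L[𝕜] X) :
    ∃ lam : ℝ,
      IsGreatest {μ : ℝ |
          Module.End.HasEigenvalue ((adjoint u * u : X →L[𝕜] X) : X →ₗ[𝕜] X) (μ : 𝕜)} lam ∧
      {x : X | ‖u x‖ = ‖u‖ * ‖x‖} =
        (Module.End.eigenspace ((adjoint u * u : X →L[𝕜] X) : X →ₗ[𝕜] X) (lam : 𝕜) : Set X) ∧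
      lam = ‖u‖ ^ 2 := by
  have hmem : ∀ (c : ℝ) (x : X), x ∈ Module.End.eigenspace
      ((adjoint u * u : X →L[𝕜] X) : X →ₗ[𝕜] X) (c : 𝕜) ↔
      adjoint u (u x) = (c : 𝕜) • x := by
    intro c x
    rw [Module.End.mem_eigenspace_iff]
    rfl
  refine ⟨‖u‖ ^ 2, ⟨?_, ?_⟩, ?_, rfl⟩
  · obtain ⟨x, hx0, hx⟩ := aux_exists u
    exact Module.End.hasEigenvalue_of_hasEigenvector
      ⟨(hmem _ x).2 ((aux_iff u x).1 hx), hx0⟩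
  · intro c hc
    obtain ⟨x, hx, hx0⟩ := Module.End.HasEigenvalue.exists_hasEigenvector hc
    have h := aux_norm_sq u x c ((hmem c x).1 hx)
    have h2 := pow_le_pow_left₀ (norm_nonneg _) (u.le_opNorm x) 2
    rw [h, mul_pow] at h2
    exact le_of_mul_le_mul_right h2 (pow_pos (norm_pos_iff.2 hx0) 2)
  · ext x
    exact (aux_iff u x).trans (hmem _ x).symm
end

section
/- Let ‖·‖ be a norm on K^n, where K = ℝ or ℂ, and equip n×n matrices with the corresponding operator norm ‖·‖_op. Let Q be an invertible n×n matrix and let A be a positive semi-definite matrix maximizing the determinant over the set { B positive semi-definite : ‖BQ‖_op ≤ 1 }. Then the set N(AQ) = { x ∈ K^n : ‖AQx‖ = ‖x‖ } spans K^n as a vector space. -/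
open scoped ComplexOrder

theorem aux_cont {𝕜 : Type*} [RCLike 𝕜] {n : ℕ} (N : (Fin n → 𝕜) → ℝ)
    (hN_smul : ∀ (a : 𝕜) (x : Fin n → 𝕜), N (a • x) = ‖a‖ * N x)
    (hN_add : ∀ x y, N (x + y) ≤ N x + N y) : Continuous N := by
  let p : Seminorm 𝕜 (Fin n → 𝕜) := Seminorm.of N hN_add hN_smul
  have hp : ∀ x, p x ≤ ∑ i, ‖x i‖ * N (Pi.single i 1) := by
    intro x
    have h1 : x = ∑ i, x i • (Pi.single i (1 : 𝕜) : Fin n → 𝕜) := by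
      ext j
      simp [Finset.sum_apply, Pi.single_apply]
    calc p x = p (∑ i, x i • (Pi.single i (1 : 𝕜) : Fin n → 𝕜)) := by rw [← h1]
      _ ≤ ∑ i, p (x i • (Pi.single i (1 : 𝕜) : Fin n → 𝕜)) :=
        Finset.le_sum_of_subadditive p (map_zero p).le (map_add_le_add p) _ _
      _ = ∑ i, ‖x i‖ * N (Pi.single i 1) := Finset.sum_congr rfl fun i _ => hN_smul _ _
  have h0 : ContinuousAt p 0 := by
    unfold ContinuousAt
    rw [map_zero]
    have hc : Continuous fun x : Fin n → 𝕜 => ∑ i, ‖x i‖ * N (Pi.single i 1) := by fun_prop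
    have := hc.tendsto 0
    simp only [Pi.zero_apply, norm_zero, zero_mul, Finset.sum_const_zero] at this
    exact squeeze_zero (fun x => apply_nonneg p x) hp this
  exact Seminorm.continuous_of_continuousAt_zero h0

theorem aux_pert {𝕜 : Type*} [RCLike 𝕜] {n : ℕ} (N : (Fin n → 𝕜) → ℝ)
    (hN_def : ∀ x, N x = 0 ↔ x = 0)
    (hN_nonneg : ∀ x, 0 ≤ N x)
    (hN_smul : ∀ (a : 𝕜) (x : Fin n → 𝕜), N (a • x) = ‖a‖ * N x)
    (hN_add : ∀ x y, N (x + y) ≤ N x + N y)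
    (P R : Matrix (Fin n) (Fin n) 𝕜) (hP : ∀ x, N (P.mulVec x) ≤ N x)
    (hR : ∀ x, N (P.mulVec x) = N x → R.mulVec x = 0) (ε : ℝ) (hε : 0 < ε) :
    ∃ t0 : ℝ, 0 < t0 ∧ ∀ t : ℝ, 0 < t → t ≤ t0 → ∀ x,
      N ((P + (t : 𝕜) • R).mulVec x) ≤ (1 + ε * t) * N x := by
  have hc : Continuous N := aux_cont N hN_smul hN_add
  have hcP : Continuous fun x => N (P.mulVec x) := hc.comp (by fun_prop)
  have hcR : Continuous fun x => N (R.mulVec x) := hc.comp (by fun_prop)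
  have hS : IsCompact (Metric.sphere (0 : Fin n → 𝕜) 1) := isCompact_sphere _ _
  have hK : IsCompact (Metric.sphere (0 : Fin n → 𝕜) 1 ∩ {x | ε * N x ≤ N (R.mulVec x)}) :=
    hS.inter_right (isClosed_le (by fun_prop) hcR)
  obtain ⟨C, hC⟩ := hS.bddAbove_image hcR.continuousOn
  have hC' : ∀ x, ‖x‖ = 1 → N (R.mulVec x) ≤ C := fun x hx =>
    hC ⟨x, by simpa using hx, rfl⟩
  have hδ : ∃ δ : ℝ, 0 < δ ∧ ∀ x, ‖x‖ = 1 → ε * N x ≤ N (R.mulVec x) →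
      δ ≤ N x - N (P.mulVec x) := by
    rcases Set.eq_empty_or_nonempty
      (Metric.sphere (0 : Fin n → 𝕜) 1 ∩ {x | ε * N x ≤ N (R.mulVec x)}) with h | h
    · refine ⟨1, one_pos, fun x hx hx2 => ?_⟩
      have : x ∈ (∅ : Set (Fin n → 𝕜)) := by
        rw [← h]; exact ⟨by simpa using hx, hx2⟩
      exact this.elim
    · obtain ⟨y, hy, hmin⟩ := hK.exists_isMinOn h (hc.sub hcP).continuousOn
      refine ⟨N y - N (P.mulVec y), ?_, fun x hx hx2 => hmin ⟨by simpa using hx, hx2⟩⟩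
      have hy1 : ‖y‖ = 1 := by simpa using hy.1
      have hy0 : y ≠ 0 := by
        rintro rfl; simp at hy1
      have hNy : 0 < N y := lt_of_le_of_ne (hN_nonneg y) fun h => hy0 ((hN_def y).1 h.symm)
      rcases (hP y).lt_or_eq with h1 | h1
      · linarith
      · have h2 : ε * N y ≤ N (R.mulVec y) := hy.2
        rw [hR y h1, (hN_def 0).2 rfl] at h2
        have := mul_pos hε hNy
        linarith
  obtain ⟨δ, hδ0, hδ⟩ := hδ
  refine ⟨δ / (|C| + 1), by positivity, fun t ht ht0 => ?_⟩
  have htC : t * C ≤ δ := by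
    rw [le_div_iff₀ (by positivity)] at ht0
    have := le_abs_self C
    nlinarith
  have key : ∀ x, ‖x‖ = 1 → N ((P + (t : 𝕜) • R).mulVec x) ≤ (1 + ε * t) * N x := by
    intro x hx
    have h1 : N ((P + (t : 𝕜) • R).mulVec x) ≤ N (P.mulVec x) + t * N (R.mulVec x) := by
      rw [Matrix.add_mulVec, Matrix.smul_mulVec]
      refine (hN_add _ _).trans ?_
      rw [hN_smul, RCLike.norm_ofReal, abs_of_pos ht]
    by_cases h : ε * N x ≤ N (R.mulVec x)
    · have h2 := hδ x hx h
      have h3 := mul_le_mul_of_nonneg_left (hC' x hx) ht.le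
      have h4 : 0 ≤ ε * t * N x := mul_nonneg (by positivity) (hN_nonneg x)
      linarith
    · have h3 := mul_le_mul_of_nonneg_left (not_le.1 h).le ht.le
      have := hP x
      linarith
  intro x
  by_cases hx : x = 0
  · subst hx
    simp [(hN_def 0).2 rfl]
  · have hx' : ‖x‖ ≠ 0 := norm_ne_zero_iff.2 hx
    have h1 := key (((‖x‖⁻¹ : ℝ) : 𝕜) • x) (by
      rw [norm_smul, RCLike.norm_ofReal, abs_of_nonneg (by positivity), inv_mul_cancel₀ hx'])
    rw [Matrix.mulVec_smul, hN_smul, hN_smul, RCLike.norm_ofReal,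
      abs_of_nonneg (by positivity)] at h1
    have h2 : 0 < ‖x‖⁻¹ := by positivity
    refine le_of_mul_le_mul_left ?_ h2
    linarith

theorem aux_det {𝕜 : Type*} [RCLike 𝕜] {n : ℕ}
    (A : Matrix (Fin n) (Fin n) 𝕜) (hA : A.PosDef) (u : Fin n → 𝕜) (hu : u ≠ 0) :
    ∃ c : ℝ, 0 < c ∧ ∀ t : ℝ,
      (A + (t : 𝕜) • Matrix.vecMulVec u (star u)).det = A.det * ((1 + c * t : ℝ) : 𝕜) := by
  have h1 := hA.inv.dotProduct_mulVec_pos hu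
  obtain ⟨c, hc⟩ : ∃ c : ℝ, (c : 𝕜) = star u ⬝ᵥ A⁻¹.mulVec u :=
    ⟨RCLike.re (star u ⬝ᵥ A⁻¹.mulVec u), by
      have := RCLike.pos_iff.1 h1
      apply RCLike.ext <;> simp [this.2]⟩
  refine ⟨c, by rw [← hc] at h1; exact_mod_cast h1, fun t => ?_⟩
  have hdet : IsUnit A.det := (Matrix.isUnit_iff_isUnit_det A).1 hA.isUnit
  rw [← Matrix.smul_vecMulVec, Matrix.vecMulVec_eq Unit,
    Matrix.det_add_replicateCol_mul_replicateRow hdet]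
  congr 1
  rw [Matrix.det_unique, Matrix.add_apply, Matrix.mul_assoc]
  have h2 : (Matrix.replicateRow Unit (star u) * (A⁻¹ * Matrix.replicateCol Unit ((t : 𝕜) • u)))
      default default = star u ⬝ᵥ A⁻¹.mulVec ((t : 𝕜) • u) := rfl
  rw [h2, Matrix.mulVec_smul, dotProduct_smul, ← hc, Matrix.one_apply_eq, smul_eq_mul]
  push_cast
  ring

/-- Let `N` be a norm on `𝕜ⁿ` (`𝕜 = ℝ` or `ℂ`), `opN` the induced operator norm on
`n × n` matrices, `Q` an invertible matrix, and `A` a positive semi-definite matrix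
of maximal determinant among positive semi-definite matrices `B` with `opN (BQ) ≤ 1`.
Then the set of norming vectors `{x : N (AQx) = N x}` spans `𝕜ⁿ`. -/
theorem norming_vectors_of_max_det_span
    {𝕜 : Type*} [RCLike 𝕜] {n : ℕ}
    (N : (Fin n → 𝕜) → ℝ)
    (hN_def : ∀ x, N x = 0 ↔ x = 0)
    (hN_smul : ∀ (a : 𝕜) (x : Fin n → 𝕜), N (a • x) = ‖a‖ * N x)
    (hN_add : ∀ x y, N (x + y) ≤ N x + N y)
    (opN : Matrix (Fin n) (Fin n) 𝕜 → ℝ)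
    (hopN : ∀ M : Matrix (Fin n) (Fin n) 𝕜,
      IsLeast {C : ℝ | 0 ≤ C ∧ ∀ x, N (M.mulVec x) ≤ C * N x} (opN M))
    (Q : Matrix (Fin n) (Fin n) 𝕜) (hQ : IsUnit Q)
    (A : Matrix (Fin n) (Fin n) 𝕜) (hA : A.PosSemidef) (hA1 : opN (A * Q) ≤ 1)
    (hA_max : ∀ B : Matrix (Fin n) (Fin n) 𝕜, B.PosSemidef → opN (B * Q) ≤ 1 →
      RCLike.re B.det ≤ RCLike.re A.det) :
    Submodule.span 𝕜 {x : Fin n → 𝕜 | N ((A * Q).mulVec x) = N x} = ⊤ := by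
  have hN0 : N 0 = 0 := (hN_def 0).2 rfl
  have hN_nonneg : ∀ x, 0 ≤ N x := fun x => by
    have h := hN_add x ((-1 : 𝕜) • x)
    rw [hN_smul] at h
    simp [hN0] at h
    linarith
  have hle : ∀ M : Matrix (Fin n) (Fin n) 𝕜, opN M ≤ 1 ↔ ∀ x, N (M.mulVec x) ≤ N x := by
    intro M
    constructor
    · intro h x
      have h1 := (hopN M).1.2 x
      have := mul_le_mul_of_nonneg_right h (hN_nonneg x)
      linarith
    · intro h
      exact (hopN M).2 ⟨zero_le_one, fun x => by simpa using h x⟩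
  have hdet0 : 0 < RCLike.re A.det := by
    obtain ⟨hq0, hq⟩ := (hopN Q).1
    set q := opN Q
    have hc : 0 < (q + 1)⁻¹ := by positivity
    have h1 := hA_max (((q + 1)⁻¹ : ℝ) • (1 : Matrix (Fin n) (Fin n) 𝕜))
      (Matrix.PosSemidef.one.smul hc.le) (by
        rw [hle]
        intro x
        rw [Matrix.smul_mul, Matrix.one_mul, Matrix.smul_mulVec, RCLike.real_smul_eq_coe_smul (K := 𝕜), hN_smul,
          RCLike.norm_ofReal, abs_of_pos hc, inv_mul_le_iff₀ (by positivity)]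
        have := hq x
        have := hN_nonneg x
        linarith)
    rw [RCLike.real_smul_eq_coe_smul (K := 𝕜), Matrix.det_smul, Matrix.det_one, mul_one, Fintype.card_fin, ← RCLike.ofReal_pow,
      RCLike.ofReal_re] at h1
    exact lt_of_lt_of_le (by positivity) h1
  have hApd : A.PosDef := hA.posDef_iff_det_ne_zero.2 fun h => by
    rw [h] at hdet0; simp at hdet0
  by_contra hspan
  obtain ⟨f, hf0, hf⟩ := Submodule.exists_le_ker_of_lt_top _ (lt_top_iff_ne_top.2 hspan)
  have hQd : IsUnit Q.det := (Matrix.isUnit_iff_isUnit_det Q).1 hQ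
  obtain ⟨v, hv⟩ : ∃ v : Fin n → 𝕜, ∀ x, v ⬝ᵥ Q.mulVec x = f x := by
    refine ⟨Matrix.vecMul (fun i => f (Pi.single i 1)) Q⁻¹, fun x => ?_⟩
    rw [Matrix.dotProduct_mulVec, Matrix.vecMul_vecMul, Matrix.nonsing_inv_mul _ hQd,
      Matrix.vecMul_one, LinearMap.pi_apply_eq_sum_univ f x]
    refine Finset.sum_congr rfl fun i _ => ?_
    have h : (Pi.single i (1 : 𝕜) : Fin n → 𝕜) = fun j => if i = j then 1 else 0 := by
      ext j
      simp [Pi.single_apply, eq_comm]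
    rw [smul_eq_mul, mul_comm, ← h]
  have hv0 : star v ≠ 0 := by
    intro h
    rw [star_eq_zero] at h
    apply hf0
    ext x
    simp [← hv, h]
  obtain ⟨c, hc0, hdet⟩ := aux_det A hApd (star v) hv0
  set H := Matrix.vecMulVec (star v) (star (star v)) with hH
  have hHps : H.PosSemidef := Matrix.posSemidef_vecMulVec_self_star _
  set ε : ℝ := c / (3 * (n + 1)) with hε
  have hε0 : 0 < ε := by positivity
  obtain ⟨t0, ht0, ht⟩ := aux_pert N hN_def hN_nonneg hN_smul hN_add (A * Q) (H * Q)
    ((hle _).1 hA1) (fun x hx => by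
      have : f x = 0 := hf (Submodule.subset_span hx)
      rw [← Matrix.mulVec_mulVec, hH, Matrix.vecMulVec_mulVec, star_star, hv, this]
      simp) ε hε0
  set t := min t0 (1 / c) with htdef
  have htpos : 0 < t := lt_min ht0 (by positivity)
  have htc : c * t ≤ 1 := by
    have : t ≤ 1 / c := min_le_right _ _
    rw [le_div_iff₀ hc0] at this
    linarith
  have hnε : (n : ℝ) * ε ≤ c / 3 := by
    rw [hε, mul_div_assoc', div_le_div_iff₀ (by positivity) (by positivity)]
    nlinarith
  have hεc : ε ≤ c / 3 := by
    rw [hε]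
    gcongr
    have : (0 : ℝ) ≤ n := Nat.cast_nonneg n
    linarith
  have hεt : ε * t ≤ 1 / 3 := by nlinarith
  have hpos : 0 ≤ 1 - ε * t := by linarith
  have h1 := hA_max ((1 - ε * t : ℝ) • (A + (t : 𝕜) • H))
    ((hA.add (hHps.smul (by exact_mod_cast htpos.le))).smul hpos) (by
      rw [hle]
      intro x
      have h2 := ht t htpos (min_le_left _ _) x
      rw [Matrix.smul_mul, Matrix.add_mul, Matrix.smul_mul, Matrix.smul_mulVec,
        RCLike.real_smul_eq_coe_smul (K := 𝕜), hN_smul, RCLike.norm_ofReal, abs_of_nonneg hpos]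
      have h3 := mul_le_mul_of_nonneg_left h2 hpos
      have h4 : 0 ≤ (ε * t) ^ 2 * N x := mul_nonneg (by positivity) (hN_nonneg x)
      nlinarith)
  rw [RCLike.real_smul_eq_coe_smul (K := 𝕜), Matrix.det_smul, hdet, Fintype.card_fin,
    ← RCLike.ofReal_pow, RCLike.re_ofReal_mul, RCLike.re_mul_ofReal] at h1
  have hb := one_add_mul_le_pow (show (-2 : ℝ) ≤ -(ε * t) by linarith) n
  rw [← sub_eq_add_neg] at hb
  have hb2 : 1 < (1 - ε * t) ^ n * (1 + c * t) := by
    have hct : 0 < c * t := by positivity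
    have h5 : n * ε * t ≤ c / 3 * t := by gcongr
    have h6 : 1 - c * t / 3 ≤ (1 - ε * t) ^ n := by linarith
    have h7 := mul_le_mul_of_nonneg_right h6 (show 0 ≤ 1 + c * t by linarith)
    nlinarith
  nlinarith
end

section
/- Let ‖·‖ be a norm on K^n, where K = ℝ or ℂ, equip matrices with the induced operator norm, and let Q be an invertible n×n matrix. Then the set S = { B positive semi-definite : ‖BQ‖_op ≤ 1 } is compact, there exists A ∈ S of maximal determinant in S, and any such maximizer A satisfies ‖AQ‖_op = 1. -/
open scoped ComplexOrder

/-- Let `N` be a norm on `𝕜ⁿ` (`𝕜 = ℝ` or `ℂ`, `n ≥ 1`), `opN` the induced operator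
norm on `n × n` matrices, and `Q` an invertible matrix. Then the set
`S = {B positive semi-definite : opN (BQ) ≤ 1}` is compact, it contains an element of
maximal determinant, and any such maximizer `A` satisfies `opN (AQ) = 1`. -/
theorem max_det_psd_exists_and_opNorm_eq_one
    {𝕜 : Type*} [RCLike 𝕜] {n : ℕ} (hn : 0 < n)
    (N : (Fin n → 𝕜) → ℝ)
    (hN_def : ∀ x, N x = 0 ↔ x = 0)
    (hN_smul : ∀ (a : 𝕜) (x : Fin n → 𝕜), N (a • x) = ‖a‖ * N x)
    (hN_add : ∀ x y, N (x + y) ≤ N x + N y)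
    (opN : Matrix (Fin n) (Fin n) 𝕜 → ℝ)
    (hopN : ∀ M : Matrix (Fin n) (Fin n) 𝕜,
      IsLeast {C : ℝ | 0 ≤ C ∧ ∀ x, N (M.mulVec x) ≤ C * N x} (opN M))
    (Q : Matrix (Fin n) (Fin n) 𝕜) (hQ : IsUnit Q) :
    IsCompact {B : Matrix (Fin n) (Fin n) 𝕜 | B.PosSemidef ∧ opN (B * Q) ≤ 1} ∧
    (∃ A ∈ {B : Matrix (Fin n) (Fin n) 𝕜 | B.PosSemidef ∧ opN (B * Q) ≤ 1},
      ∀ B ∈ {B : Matrix (Fin n) (Fin n) 𝕜 | B.PosSemidef ∧ opN (B * Q) ≤ 1},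
        RCLike.re B.det ≤ RCLike.re A.det) ∧
    (∀ A ∈ {B : Matrix (Fin n) (Fin n) 𝕜 | B.PosSemidef ∧ opN (B * Q) ≤ 1},
      (∀ B ∈ {B : Matrix (Fin n) (Fin n) 𝕜 | B.PosSemidef ∧ opN (B * Q) ≤ 1},
        RCLike.re B.det ≤ RCLike.re A.det) → opN (A * Q) = 1) := by
  classical
  have N0 : ∀ x, 0 ≤ N x := by
    intro x
    have h1 := hN_add x ((-1 : 𝕜) • x)
    rw [hN_smul] at h1
    have h2 : x + (-1 : 𝕜) • x = 0 := by simp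
    rw [h2, (hN_def 0).2 rfl] at h1
    simp at h1
    linarith
  have hle : ∀ M : Matrix (Fin n) (Fin n) 𝕜, opN M ≤ 1 ↔ ∀ x, N (M.mulVec x) ≤ N x := by
    intro M
    constructor
    · intro h x
      refine ((hopN M).1.2 x).trans ?_
      nlinarith [N0 x]
    · intro h
      exact (hopN M).2 ⟨zero_le_one, fun x => by simpa using h x⟩
  have Nsum : ∀ x, N x ≤ (∑ i, N (Pi.single i 1)) * ‖x‖ := by
    intro x
    have key : ∀ s : Finset (Fin n), N (∑ i ∈ s, x i • Pi.single i (1 : 𝕜)) ≤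
        ∑ i ∈ s, ‖x i‖ * N (Pi.single i 1) := by
      intro s
      induction s using Finset.induction_on with
      | empty => simp [(hN_def 0).2 rfl]
      | insert a s ha ih =>
        rw [Finset.sum_insert ha, Finset.sum_insert ha]
        refine (hN_add _ _).trans ?_
        rw [hN_smul]
        linarith
    have hx : x = ∑ i, x i • Pi.single i (1 : 𝕜) := pi_eq_sum_univ' x
    have := key Finset.univ
    rw [← hx] at this
    refine this.trans ?_
    rw [Finset.sum_mul]
    refine Finset.sum_le_sum fun i _ => ?_
    rw [mul_comm]
    exact mul_le_mul_of_nonneg_left (norm_le_pi_norm x i) (N0 _)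
  have Ncont : Continuous N := by
    set K : ℝ := ∑ i, N (Pi.single i (1 : 𝕜)) with hK
    have hK0 : 0 ≤ K := Finset.sum_nonneg fun i _ => N0 _
    have : LipschitzWith (Real.toNNReal K) N := by
      refine LipschitzWith.of_le_add_mul _ fun x y => ?_
      rw [Real.coe_toNNReal _ hK0, dist_eq_norm]
      have h1 := hN_add y (x - y)
      have h2 := Nsum (x - y)
      rw [add_sub_cancel] at h1
      linarith
    exact this.continuous
  obtain ⟨c, hc, hcN⟩ : ∃ c : ℝ, 0 < c ∧ ∀ x : Fin n → 𝕜, c * ‖x‖ ≤ N x := by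
    haveI : Nonempty (Fin n) := ⟨⟨0, hn⟩⟩
    have hne : (Metric.sphere (0 : Fin n → 𝕜) 1).Nonempty :=
      ⟨fun _ => 1, by simp [pi_norm_const]⟩
    obtain ⟨x0, hx0, hmin⟩ := (isCompact_sphere (0 : Fin n → 𝕜) 1).exists_isMinOn hne
      Ncont.continuousOn
    refine ⟨N x0, lt_of_le_of_ne (N0 _) ?_, fun x => ?_⟩
    · intro h
      have := (hN_def x0).1 h.symm
      subst this
      simp at hx0
    · by_cases hx : x = 0
      · subst hx
        simp [(hN_def 0).2 rfl]
      · have hx' : 0 < ‖x‖ := norm_pos_iff.2 hx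
        have hm : ((‖x‖⁻¹ : ℝ) : 𝕜) • x ∈ Metric.sphere (0 : Fin n → 𝕜) 1 := by
          simp [norm_smul, hx'.ne']
        have h := hmin hm
        simp only [Set.mem_setOf_eq, hN_smul] at h
        rw [RCLike.norm_ofReal, abs_of_pos (inv_pos.2 hx')] at h
        calc N x0 * ‖x‖ ≤ (‖x‖⁻¹ * N x) * ‖x‖ := by gcongr
          _ = N x := by field_simp
  have hdetQ : IsUnit Q.det := (Matrix.isUnit_iff_isUnit_det Q).1 hQ
  have hcomp : IsCompact {B : Matrix (Fin n) (Fin n) 𝕜 | B.PosSemidef ∧ opN (B * Q) ≤ 1} := by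
    have hcl : IsClosed {B : Matrix (Fin n) (Fin n) 𝕜 | B.PosSemidef ∧ opN (B * Q) ≤ 1} := by
      have : {B : Matrix (Fin n) (Fin n) 𝕜 | B.PosSemidef ∧ opN (B * Q) ≤ 1} =
          {B | B.conjTranspose = B} ∩ (⋂ x : Fin n → 𝕜, {B | 0 ≤ star x ⬝ᵥ B.mulVec x}) ∩
          ⋂ x : Fin n → 𝕜, {B | N ((B * Q).mulVec x) ≤ N x} := by
        ext B
        simp only [Set.mem_setOf_eq, Set.mem_inter_iff, Set.mem_iInter, hle,
          Matrix.posSemidef_iff_dotProduct_mulVec]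
        rfl
      rw [this]
      refine IsClosed.inter (IsClosed.inter ?_ ?_) ?_
      · exact isClosed_eq (by fun_prop) (by fun_prop)
      · refine isClosed_iInter fun x => isClosed_le continuous_const ?_
        fun_prop
      · refine isClosed_iInter fun x => isClosed_le (Ncont.comp ?_) continuous_const
        fun_prop
    have hT : IsCompact (Set.pi Set.univ fun _ : Fin n => Set.pi Set.univ fun j : Fin n =>
        Metric.closedBall (0 : 𝕜) (N (Pi.single j 1) / c)) :=
      isCompact_univ_pi fun i => isCompact_univ_pi fun j => isCompact_closedBall _ _
    have hf : Continuous fun M : Matrix (Fin n) (Fin n) 𝕜 => M * Q⁻¹ := by fun_prop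
    refine (hT.image hf).of_isClosed_subset hcl ?_
    rintro B ⟨-, hB⟩
    refine ⟨B * Q, ?_, ?_⟩
    · intro i _ j _
      rw [mem_closedBall_zero_iff, le_div_iff₀ hc]
      have h1 := (hle _).1 hB (Pi.single j 1)
      have h2 := hcN ((B * Q).mulVec (Pi.single j 1))
      have h3 := norm_le_pi_norm ((B * Q).mulVec (Pi.single j 1)) i
      rw [Matrix.mulVec_single_one] at h1 h2 h3
      simp only [Matrix.col_apply] at h3
      nlinarith
    · exact Matrix.mul_nonsing_inv_cancel_right _ _ hdetQ
  have hreal : ∀ (s : ℝ) (A : Matrix (Fin n) (Fin n) 𝕜),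
      RCLike.re ((s : 𝕜) • A).det = s ^ n * RCLike.re A.det := by
    intro s A
    rw [Matrix.det_smul, Fintype.card_fin, ← RCLike.ofReal_pow, RCLike.re_ofReal_mul]
  have hscale : ∀ (s : ℝ) (A : Matrix (Fin n) (Fin n) 𝕜), 0 ≤ s → A.PosSemidef →
      s * opN (A * Q) ≤ 1 →
      ((s : 𝕜) • A).PosSemidef ∧ opN (((s : 𝕜) • A) * Q) ≤ 1 := by
    intro s A hs hA h
    refine ⟨hA.smul (RCLike.ofReal_nonneg.2 hs), (hle _).2 fun x => ?_⟩
    rw [Matrix.smul_mul, Matrix.smul_mulVec, hN_smul, RCLike.norm_ofReal, abs_of_nonneg hs]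
    have h1 := mul_le_mul_of_nonneg_left ((hopN (A * Q)).1.2 x) hs
    nlinarith [N0 x]
  refine ⟨hcomp, ?_, ?_⟩
  · have hne : {B : Matrix (Fin n) (Fin n) 𝕜 | B.PosSemidef ∧ opN (B * Q) ≤ 1}.Nonempty := by
      refine ⟨_, hscale 0 1 le_rfl Matrix.PosSemidef.one (by simp)⟩
    have hd : Continuous fun B : Matrix (Fin n) (Fin n) 𝕜 => RCLike.re B.det :=
      RCLike.continuous_re.comp (continuous_id.matrix_det)
    obtain ⟨A, hA, h⟩ := hcomp.exists_isMaxOn hne hd.continuousOn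
    exact ⟨A, hA, fun B hB => h hB⟩
  · rintro A ⟨hA, hA1⟩ hmax
    have hpos : 0 < RCLike.re A.det := by
      have h0 : 0 ≤ opN (1 * Q) := (hopN _).1.1
      have he : 0 < (opN (1 * Q) + 1)⁻¹ := by positivity
      have h := hmax _ (hscale (opN (1 * Q) + 1)⁻¹ 1 he.le Matrix.PosSemidef.one (by
        rw [inv_mul_le_iff₀ (by positivity)]; linarith))
      rw [hreal] at h
      simp only [Matrix.det_one, RCLike.one_re, mul_one] at h
      exact lt_of_lt_of_le (pow_pos he n) h
    by_contra hne
    have hlt : opN (A * Q) < 1 := lt_of_le_of_ne hA1 hne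
    have hm0 : 0 < max (opN (A * Q)) (1 / 2) := lt_of_lt_of_le (by norm_num) (le_max_right _ _)
    have hm1 : max (opN (A * Q)) (1 / 2) < 1 := max_lt hlt (by norm_num)
    have h := hmax _ (hscale (max (opN (A * Q)) (1 / 2))⁻¹ A (inv_pos.2 hm0).le hA (by
        rw [inv_mul_le_iff₀ hm0, mul_one]; exact le_max_left _ _))
    rw [hreal] at h
    have h1 : 1 < (max (opN (A * Q)) (1 / 2))⁻¹ ^ n :=
      one_lt_pow₀ ((one_lt_inv₀ hm0).2 hm1) hn.ne'
    nlinarith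
end

section
/- Let T be a nonempty compact topological space and let f, g : T → K be continuous functions (K = ℝ or ℂ, and ‖·‖ denotes the sup norm on C(T)). Assume that for every t ∈ T with |f(t)| = ‖f‖ one has Re( f(t)·conj(g(t)) ) < 0. Then there exists δ₀ > 0 such that for every δ with 0 < δ < δ₀, ‖f + δ·g‖ < ‖f‖. -/
open Topology in
/-- Let `T` be a nonempty compact topological space and `f, g : T → 𝕜` continuous
(`𝕜 = ℝ` or `ℂ`), with the sup norm on `C(T, 𝕜)`. If `Re (f t * conj (g t)) < 0`
for every `t` with `‖f t‖ = ‖f‖`, then `‖f + δ • g‖ < ‖f‖` for all sufficiently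
small `δ > 0`. -/
theorem sup_norm_decreases_of_neg_re_on_peak
    {𝕜 : Type*} [RCLike 𝕜] {T : Type*} [TopologicalSpace T] [CompactSpace T]
    [Nonempty T] (f g : C(T, 𝕜))
    (h : ∀ t : T, ‖f t‖ = ‖f‖ → RCLike.re (f t * (starRingEnd 𝕜) (g t)) < 0) :
    ∃ δ₀ : ℝ, 0 < δ₀ ∧ ∀ δ : ℝ, 0 < δ → δ < δ₀ → ‖f + δ • g‖ < ‖f‖ := by
  have key : ∀ᶠ δ : ℝ in 𝓝 (0 : ℝ), ∀ t ∈ (Set.univ : Set T),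
      0 < δ → ‖f t + (δ : 𝕜) * g t‖ < ‖f‖ := by
    refine isCompact_univ.eventually_forall_of_forall_eventually ?_
    intro t _
    by_cases ht : ‖f t‖ = ‖f‖
    · have hc : Continuous (fun z : ℝ × T =>
          2 * RCLike.re (f z.2 * (starRingEnd 𝕜) (g z.2)) + z.1 * ‖g z.2‖ ^ 2) := by
        have hr : Continuous (fun z : ℝ × T =>
            RCLike.re (f z.2 * (starRingEnd 𝕜) (g z.2))) :=
          RCLike.continuous_re.comp ((f.continuous.comp continuous_snd).mul
            (RCLike.continuous_conj.comp (g.continuous.comp continuous_snd)))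
        fun_prop
      have h0 : (fun z : ℝ × T =>
          2 * RCLike.re (f z.2 * (starRingEnd 𝕜) (g z.2)) + z.1 * ‖g z.2‖ ^ 2) (0, t) < 0 := by
        have := h t ht
        simp only [zero_mul, add_zero]
        linarith
      filter_upwards [hc.continuousAt.eventually_lt continuousAt_const h0] with z hz hpos
      have e : ‖f z.2 + (z.1 : 𝕜) * g z.2‖ ^ 2 = ‖f z.2‖ ^ 2
          + z.1 * (2 * RCLike.re (f z.2 * (starRingEnd 𝕜) (g z.2)) + z.1 * ‖g z.2‖ ^ 2) := by
        have h1 : f z.2 * (starRingEnd 𝕜) ((z.1 : 𝕜) * g z.2)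
            = (z.1 : 𝕜) * (f z.2 * (starRingEnd 𝕜) (g z.2)) := by
          rw [map_mul, RCLike.conj_ofReal]; ring
        rw [← RCLike.normSq_eq_def', RCLike.normSq_add, h1, RCLike.re_ofReal_mul,
          RCLike.normSq_eq_def', RCLike.normSq_eq_def', norm_mul, RCLike.norm_ofReal, mul_pow,
          sq_abs]
        ring
      have h2 := mul_neg_of_pos_of_neg hpos hz
      have h3 : ‖f z.2 + (z.1 : 𝕜) * g z.2‖ < ‖f z.2‖ :=
        lt_of_pow_lt_pow_left₀ 2 (norm_nonneg _) (by linarith)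
      exact h3.trans_le (f.norm_coe_le_norm z.2)
    · have hlt : ‖f t‖ < ‖f‖ := lt_of_le_of_ne (f.norm_coe_le_norm t) ht
      have hc : Continuous (fun z : ℝ × T => ‖f z.2 + (z.1 : 𝕜) * g z.2‖) := by
        fun_prop
      have h0 : (fun z : ℝ × T => ‖f z.2 + (z.1 : 𝕜) * g z.2‖) (0, t) < ‖f‖ := by
        simpa using hlt
      filter_upwards [hc.continuousAt.eventually_lt continuousAt_const h0] with z hz _
      exact hz
  obtain ⟨ε, hε, H⟩ := Metric.eventually_nhds_iff.1 key
  refine ⟨ε, hε, fun δ h1 h2 => ?_⟩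
  rw [ContinuousMap.norm_lt_iff_of_nonempty]
  intro t
  have := H (y := δ) (by simpa [abs_of_pos h1] using h2) t (Set.mem_univ t) h1
  simpa [RCLike.real_smul_eq_coe_mul] using this
end

section
/- Let X be a finite-dimensional normed space over ℝ or ℂ and let Iso(X) = { u : X → X linear : ‖u(x)‖ = ‖x‖ for all x ∈ X } be its group of linear isometries. Then there exists an inner product ⟨·,·⟩ on X which is invariant under Iso(X), i.e., ⟨u(x), u(y)⟩ = ⟨x,y⟩ for all u ∈ Iso(X) and all x, y ∈ X. -/
open MeasureTheory Measure in
/-- On a finite-dimensional normed space over ℝ or ℂ there exists an inner product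
which is invariant under every linear isometry of the space. -/
theorem exists_isometry_invariant_inner
    {𝕜 : Type*} [RCLike 𝕜] (X : Type*) [NormedAddCommGroup X] [NormedSpace 𝕜 X]
    [FiniteDimensional 𝕜 X] :
    ∃ inn : X → X → 𝕜,
      (∀ x y, inn x y = (starRingEnd 𝕜) (inn y x)) ∧
      (∀ x y z, inn (x + y) z = inn x z + inn y z) ∧
      (∀ (a : 𝕜) (x y : X), inn (a • x) y = a * inn x y) ∧
      (∀ x, x ≠ 0 → 0 < RCLike.re (inn x x)) ∧
      (∀ u : X →ₗ[𝕜] X, (∀ x, ‖u x‖ = ‖x‖) →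
        ∀ x y, inn (u x) (u y) = inn x y) := by
  let D := X →L[𝕜] 𝕜
  have : FiniteDimensional ℝ D := FiniteDimensional.trans ℝ 𝕜 D
  have : ProperSpace D := FiniteDimensional.proper ℝ D
  let : MeasurableSpace D := borel D
  have : BorelSpace D := ⟨rfl⟩
  let μ : Measure D := μH[Module.finrank ℝ D]
  have : μ.IsAddHaarMeasure := isAddHaarMeasure_hausdorffMeasure
  let B : Set D := Metric.closedBall 0 1
  have hc : ∀ x y : X, Continuous (fun f : D => f x * (starRingEnd 𝕜) (f y)) := by
    intro x y
    have h : ∀ z : X, Continuous (fun f : D => f z) := fun z =>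
      (ContinuousLinearMap.apply 𝕜 𝕜 z).continuous
    exact (h x).mul (RCLike.continuous_conj.comp (h y))
  have hi : ∀ x y : X, IntegrableOn (fun f : D => f x * (starRingEnd 𝕜) (f y)) B μ :=
    fun x y => (hc x y).continuousOn.integrableOn_compact (isCompact_closedBall 0 1)
  refine ⟨fun x y => ∫ f in B, f x * (starRingEnd 𝕜) (f y) ∂μ, ?_, ?_, ?_, ?_, ?_⟩
  · intro x y
    rw [← integral_conj]
    simp [mul_comm]
  · intro x y z
    rw [← integral_add (hi x z) (hi y z)]
    simp [add_mul]
  · intro a x y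
    rw [← integral_const_mul]
    simp [mul_assoc]
  · intro x hx
    have hre := integral_re (hi x x)
    show 0 < RCLike.re (∫ f in B, f x * (starRingEnd 𝕜) (f x) ∂μ)
    rw [← hre]
    have hn : ∀ f : D, RCLike.re (f x * (starRingEnd 𝕜) (f x)) = ‖f x‖ ^ 2 := by
      intro f
      rw [RCLike.mul_conj, ← RCLike.ofReal_pow, RCLike.ofReal_re]
    have hcx : Continuous (fun f : D => RCLike.re (f x * (starRingEnd 𝕜) (f x))) :=
      RCLike.continuous_re.comp (hc x x)
    have hix := (hi x x).re
    rw [integral_pos_iff_support_of_nonneg (fun f => by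
      simp only [Pi.zero_apply]; rw [hn]; positivity) hix]
    obtain ⟨g, hg, hgx⟩ := exists_dual_vector 𝕜 x (norm_ne_zero_iff.mpr hx)
    rw [Measure.restrict_apply (hcx.isOpen_support).measurableSet]
    have hO : IsOpen (Function.support (fun f : D => RCLike.re (f x * (starRingEnd 𝕜) (f x)))
      ∩ Metric.ball 0 1) := (hcx.isOpen_support).inter Metric.isOpen_ball
    refine lt_of_lt_of_le (hO.measure_pos μ ⟨((2⁻¹ : ℝ) : 𝕜) • g, ?_, ?_⟩)
      (measure_mono (Set.inter_subset_inter_right _ Metric.ball_subset_closedBall))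
    · rw [Function.mem_support, hn]
      simp [hgx, hx]
    · rw [mem_ball_zero_iff, norm_smul, hg, RCLike.norm_ofReal]
      norm_num [abs_of_pos]
  · intro u hu x y
    let v : X →ₗᵢ[𝕜] X := ⟨u, hu⟩
    let e : X ≃ₗᵢ[𝕜] X := v.toLinearIsometryEquiv rfl
    have he : ∀ z, e z = u z := fun z => rfl
    let T : D ≃ᵢ D :=
      { toFun := fun f => f.comp (e : X →L[𝕜] X)
        invFun := fun f => f.comp (e.symm : X →L[𝕜] X)
        left_inv := fun f => by ext z; simp
        right_inv := fun f => by ext z; simp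
        isometry_toFun := by
          refine Isometry.of_dist_eq fun f g => ?_
          rw [dist_eq_norm, dist_eq_norm, ← ContinuousLinearMap.sub_comp]
          exact ContinuousLinearMap.opNorm_comp_linearIsometryEquiv (f - g) e }
    have hT : MeasurePreserving T μ μ := T.measurePreserving_hausdorffMeasure _
    have hB : T ⁻¹' B = B := by
      have h0 : T 0 = 0 := ContinuousLinearMap.zero_comp _
      have := T.preimage_closedBall 0 1
      rw [show T.symm 0 = 0 by rw [← h0, T.symm_apply_apply, h0]] at this
      exact this
    have := hT.setIntegral_preimage_emb T.toHomeomorph.measurableEmbedding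
      (fun f : D => f x * (starRingEnd 𝕜) (f y)) B
    rw [hB] at this
    exact this
end

section
/- Let ‖·‖ be a norm on ℝ^n such that every linear ‖·‖-isometry of ℝ^n is an orthogonal matrix, and such that for every linear operator u : ℝ^n → ℝ^n the set of norming vectors N(u) = { x : ‖u(x)‖ = ‖u‖_op·‖x‖ } is a linear subspace. Then every orthogonal matrix Q ∈ O_n is a ‖·‖-isometry, i.e., ‖Qx‖ = ‖x‖ for all x ∈ ℝ^n. -/
open Matrix

structure IsNm {n : ℕ} (N : (Fin n → ℝ) → ℝ) : Prop where
  zero : ∀ x, N x = 0 ↔ x = 0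
  smul : ∀ (a : ℝ) (x : Fin n → ℝ), N (a • x) = |a| * N x
  add : ∀ x y, N (x + y) ≤ N x + N y

namespace IsNm

variable {n : ℕ} {N : (Fin n → ℝ) → ℝ}

theorem nonneg (h : IsNm N) (x : Fin n → ℝ) : 0 ≤ N x := by
  have h1 := h.add x ((-1 : ℝ) • x)
  have h2 : x + (-1 : ℝ) • x = 0 := by simp
  rw [h2, (h.zero 0).2 rfl, h.smul] at h1
  simp at h1
  linarith

theorem pos (h : IsNm N) {x : Fin n → ℝ} (hx : x ≠ 0) : 0 < N x :=
  lt_of_le_of_ne (h.nonneg x) (fun e => hx ((h.zero x).1 e.symm))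

theorem cont (h : IsNm N) : Continuous N := by
  have hc : ConvexOn ℝ Set.univ N := by
    refine ⟨convex_univ, fun x _ y _ a b ha hb _ => ?_⟩
    refine (h.add _ _).trans ?_
    rw [h.smul, h.smul, abs_of_nonneg ha, abs_of_nonneg hb]
    simp
  have := hc.continuousOn isOpen_univ
  exact continuousOn_univ.1 this

theorem lower (h : IsNm N) : ∃ c : ℝ, 0 < c ∧ ∀ x, ‖x‖ ≤ c * N x := by
  obtain ⟨a, ha, hb⟩ := (isCompact_sphere (0 : Fin n → ℝ) 1).exists_forall_le'
    h.cont.continuousOn (a := 0) (by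
      intro b hb
      apply h.pos
      rintro rfl
      simp at hb)
  refine ⟨a⁻¹, inv_pos.2 ha, fun x => ?_⟩
  by_cases hx : x = 0
  · subst hx; simp [(h.zero 0).2 rfl]
  have hx' : 0 < ‖x‖ := norm_pos_iff.2 hx
  have := hb (‖x‖⁻¹ • x) (by simp [norm_smul, hx'.ne'])
  rw [h.smul, abs_of_pos (inv_pos.2 hx')] at this
  rw [inv_mul_eq_div, le_div_iff₀ ha]
  rw [inv_mul_eq_div, le_div_iff₀ hx'] at this
  linarith

theorem compact_sphere (h : IsNm N) : IsCompact {x | N x = 1} := by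
  obtain ⟨c, hc, hb⟩ := h.lower
  refine (isCompact_closedBall (0 : Fin n → ℝ) c).of_isClosed_subset
    (isClosed_eq h.cont continuous_const) ?_
  intro x hx
  have := hb x
  rw [show N x = 1 from hx] at this
  simpa using this

theorem compact_ball (h : IsNm N) :
    IsCompact {A : Matrix (Fin n) (Fin n) ℝ | ∀ z, N (A *ᵥ z) ≤ N z} := by
  obtain ⟨c, hc, hb⟩ := h.lower
  have hK : IsCompact (Set.pi Set.univ fun _ : Fin n => Set.pi Set.univ fun j : Fin n =>
      Set.Icc (-(c * N (Pi.single j 1))) (c * N (Pi.single j 1))) :=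
    isCompact_univ_pi fun _ => isCompact_univ_pi fun _ => isCompact_Icc
  refine IsCompact.of_isClosed_subset (X := Matrix (Fin n) (Fin n) ℝ) hK ?_ ?_
  · rw [Set.ofPred_forall]
    refine isClosed_iInter fun z => isClosed_le (h.cont.comp ?_) continuous_const
    fun_prop
  · intro A hA i _ j _
    have h1 := hb (A *ᵥ Pi.single j 1)
    have h2 := hA (Pi.single j 1)
    have h3 := norm_le_pi_norm (A *ᵥ Pi.single j 1) i
    simp only [mulVec_single_one, col_apply, Real.norm_eq_abs] at h1 h2 h3
    rw [Set.mem_Icc, ← abs_le]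
    exact h3.trans (h1.trans (by gcongr))

theorem perturb (h : IsNm N) (A : Matrix (Fin n) (Fin n) ℝ) (hA : ∀ z, N (A *ᵥ z) ≤ N z)
    (φ v : Fin n → ℝ) (hφ : ∀ z, N (A *ᵥ z) = N z → φ ⬝ᵥ z = 0) (δ : ℝ) (hδ : 0 < δ) :
    ∃ t : ℝ, 0 < t ∧ t ≤ 1 / 2 ∧ ∀ z, N (A *ᵥ z + (t * (φ ⬝ᵥ z)) • v) ≤ (1 + δ * t) * N z := by
  have cA : Continuous fun z => N (A *ᵥ z) := h.cont.comp (by fun_prop)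
  have cφ : Continuous fun z : Fin n → ℝ => |φ ⬝ᵥ z| * N v := by fun_prop
  have hK : IsCompact ({z | N z = 1} ∩ {z | δ ≤ |φ ⬝ᵥ z| * N v}) :=
    h.compact_sphere.inter_right (isClosed_le continuous_const cφ)
  obtain ⟨η, hη, hη'⟩ := hK.exists_forall_le' (f := fun z => 1 - N (A *ᵥ z)) (a := 0)
    (continuous_const.sub cA).continuousOn (by
      rintro z ⟨hz1, hz2⟩
      have hz1 : N z = 1 := hz1
      have hz2 : δ ≤ |φ ⬝ᵥ z| * N v := hz2
      have h1 := hA z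
      have h2 : N (A *ᵥ z) ≠ N z := by
        intro e
        rw [hφ z e] at hz2
        simp at hz2
        linarith
      have := lt_of_le_of_ne h1 h2
      linarith)
  obtain ⟨C, hC⟩ := h.compact_sphere.exists_bound_of_continuousOn cφ.continuousOn
  have hC1 : 0 < max C 1 := by positivity
  have ht : 0 < min (1 / 2) (η / max C 1) := by positivity
  refine ⟨min (1 / 2) (η / max C 1), ht, min_le_left _ _, ?_⟩
  set t := min (1 / 2) (η / max C 1) with htd
  have htC : t * max C 1 ≤ η := by
    rw [← le_div_iff₀ hC1]; exact min_le_right _ _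
  have main : ∀ z, N z = 1 → N (A *ᵥ z + (t * (φ ⬝ᵥ z)) • v) ≤ 1 + δ * t := by
    intro z hz
    refine (h.add _ _).trans ?_
    rw [h.smul, abs_mul, abs_of_pos ht, mul_assoc]
    have h1 := hA z
    rw [hz] at h1
    by_cases hd : δ ≤ |φ ⬝ᵥ z| * N v
    · have h2 := hη' z ⟨hz, hd⟩
      have h3 := hC z hz
      rw [Real.norm_eq_abs] at h3
      have h4 : |φ ⬝ᵥ z| * N v ≤ max C 1 := (le_abs_self _).trans (h3.trans (le_max_left _ _))
      have h5 := mul_le_mul_of_nonneg_left h4 ht.le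
      have : 0 < δ * t := by positivity
      linarith
    · push Not at hd
      have h5 := mul_le_mul_of_nonneg_left hd.le ht.le
      linarith
  intro z
  by_cases hz : z = 0
  · subst hz; simp [(h.zero 0).2 rfl]
  have hp := h.pos hz
  have h1 := main ((N z)⁻¹ • z) (by
    rw [h.smul, abs_of_pos (inv_pos.2 hp), inv_mul_cancel₀ hp.ne'])
  have h2 : A *ᵥ ((N z)⁻¹ • z) + (t * (φ ⬝ᵥ ((N z)⁻¹ • z))) • v
      = (N z)⁻¹ • (A *ᵥ z + (t * (φ ⬝ᵥ z)) • v) := by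
    rw [mulVec_smul, dotProduct_smul, smul_add, smul_smul, smul_eq_mul]
    congr 2; ring
  rw [h2, h.smul, abs_of_pos (inv_pos.2 hp), inv_mul_eq_div, div_le_iff₀ hp] at h1
  exact h1

theorem hahn (h : IsNm N) (x : Fin n → ℝ) (hx : x ≠ 0) :
    ∃ f : Fin n → ℝ, f ⬝ᵥ x = N x ∧ ∀ z, |f ⬝ᵥ z| ≤ N z := by
  obtain ⟨g, hg1, hg2⟩ := exists_extension_of_le_sublinear
    (LinearPMap.mkSpanSingleton (K := ℝ) x (N x) hx) N
    (fun c hc x => by rw [h.smul, abs_of_pos hc]) h.add (by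
      rintro ⟨z, hz⟩
      obtain ⟨c, rfl⟩ := Submodule.mem_span_singleton.1 hz
      erw [LinearPMap.mkSpanSingleton'_apply]
      rw [h.smul]
      exact mul_le_mul_of_nonneg_right (le_abs_self c) (h.nonneg x))
  have hd : ∀ z, (fun i => g (Pi.single i 1)) ⬝ᵥ z = g z := by
    intro z
    have : (fun i => g (Pi.single i 1)) = (dotProductEquiv ℝ (Fin n)).symm g :=
      funext fun i => (dotProductEquiv_symm_apply ℝ (Fin n) g i).symm
    rw [this, ← dotProductEquiv_apply_apply, LinearEquiv.apply_symm_apply]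
  refine ⟨fun i => g (Pi.single i 1), ?_, ?_⟩
  · rw [hd]
    have := hg1 ⟨x, Submodule.mem_span_singleton_self x⟩
    rw [this]
    exact LinearPMap.mkSpanSingleton_apply ℝ ℝ hx (N x)
  · intro z
    rw [hd, abs_le]
    refine ⟨?_, hg2 z⟩
    have := hg2 ((-1 : ℝ) • z)
    rw [h.smul] at this
    simp at this
    linarith

end IsNm

theorem det_one_add_vv {n : ℕ} (u v : Fin n → ℝ) : (1 + vecMulVec u v).det = 1 + v ⬝ᵥ u := by
  rw [← det_one_add_replicateCol_mul_replicateRow (ι := Unit), vecMulVec_eq Unit]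

noncomputable def FF {n : ℕ} (y x : Fin n → ℝ) (m : ℕ) (A : Matrix (Fin n) (Fin n) ℝ) : ℝ :=
  |A.det| * ((y ⬝ᵥ A *ᵥ x) ^ 2) ^ m

theorem FF_smul {n : ℕ} (y x : Fin n → ℝ) (m : ℕ) (A : Matrix (Fin n) (Fin n) ℝ) (c : ℝ)
    (hc : 0 ≤ c) : FF y x m (c • A) = c ^ (n + 2 * m) * FF y x m A := by
  unfold FF
  rw [det_smul, smul_mulVec, dotProduct_smul, abs_mul, abs_of_nonneg (by positivity)]
  simp only [Fintype.card_fin, smul_eq_mul]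
  rw [mul_pow, mul_pow, pow_add, pow_mul]
  ring

theorem FF_le {n : ℕ} {N : (Fin n → ℝ) → ℝ} (h : IsNm N) (y x : Fin n → ℝ) (m : ℕ)
    (B : Matrix (Fin n) (Fin n) ℝ)
    (hB : ∀ A : Matrix (Fin n) (Fin n) ℝ, (∀ z, N (A *ᵥ z) ≤ N z) → FF y x m A ≤ FF y x m B)
    (A : Matrix (Fin n) (Fin n) ℝ) (c : ℝ) (hc : 0 < c) (hA : ∀ z, N (A *ᵥ z) ≤ c * N z) :
    FF y x m A ≤ c ^ (n + 2 * m) * FF y x m B := by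
  have h1 := hB (c⁻¹ • A) (by
    intro z
    rw [smul_mulVec, h.smul, abs_of_pos (inv_pos.2 hc), inv_mul_le_iff₀ hc]
    exact hA z)
  have h2 : FF y x m A = c ^ (n + 2 * m) * FF y x m (c⁻¹ • A) := by
    rw [← FF_smul _ _ _ _ _ hc.le, smul_smul, mul_inv_cancel₀ hc.ne', one_smul]
  rw [h2]
  gcongr

theorem key {n : ℕ} {N : (Fin n → ℝ) → ℝ} (h : IsNm N)
    (opN : ((Fin n → ℝ) →ₗ[ℝ] (Fin n → ℝ)) → ℝ)
    (hopN : ∀ u : (Fin n → ℝ) →ₗ[ℝ] (Fin n → ℝ),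
      IsLeast {C : ℝ | 0 ≤ C ∧ ∀ x, N (u x) ≤ C * N x} (opN u))
    (hnorming : ∀ u : (Fin n → ℝ) →ₗ[ℝ] (Fin n → ℝ),
      ∃ S : Submodule ℝ (Fin n → ℝ),
        (S : Set (Fin n → ℝ)) = {x : Fin n → ℝ | N (u x) = opN u * N x})
    (y x : Fin n → ℝ) (m : ℕ) (hm : 1 ≤ m)
    (B : Matrix (Fin n) (Fin n) ℝ) (hBc : ∀ z, N (B *ᵥ z) ≤ N z)
    (hB : ∀ A : Matrix (Fin n) (Fin n) ℝ, (∀ z, N (A *ᵥ z) ≤ N z) → FF y x m A ≤ FF y x m B)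
    (hpos : 0 < FF y x m B) : ∀ z, N (B *ᵥ z) = N z := by
  obtain ⟨⟨ho0, hole⟩, homin⟩ := hopN (toLin' B)
  obtain ⟨S, hS⟩ := hnorming (toLin' B)
  simp only [toLin'_apply] at hole hS
  set o := opN (toLin' B) with hod
  have ho1 : o ≤ 1 := homin ⟨zero_le_one, by simpa using hBc⟩
  have hk : n + 2 * m ≠ 0 := by omega
  have hSm : ∀ z, z ∈ S ↔ N (B *ᵥ z) = o * N z := fun z => by
    rw [← SetLike.mem_coe, hS]; rfl
  -- the operator norm is one
  have ho : o = 1 := by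
    by_contra hne
    have hlt : (o + 1) / 2 < 1 := by
      have := lt_of_le_of_ne ho1 hne
      linarith
    have h1 := FF_le h y x m B hB B ((o + 1) / 2) (by linarith) (fun z =>
      (hole z).trans (mul_le_mul_of_nonneg_right (by linarith) (h.nonneg z)))
    have h2 : ((o + 1) / 2) ^ (n + 2 * m) < 1 := pow_lt_one₀ (by linarith) hlt hk
    nlinarith
  rw [ho] at hSm
  simp only [one_mul] at hSm
  by_cases hT : S = ⊤
  · intro z
    rw [← hSm, hT]; trivial
  exfalso
  obtain ⟨f, hf0, hf⟩ := S.exists_le_ker_of_lt_top (lt_top_iff_ne_top.2 hT)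
  obtain ⟨φ, hφ⟩ : ∃ φ : Fin n → ℝ, ∀ z, φ ⬝ᵥ z = f z := by
    refine ⟨(dotProductEquiv ℝ (Fin n)).symm f, fun z => ?_⟩
    rw [← dotProductEquiv_apply_apply, LinearEquiv.apply_symm_apply]
  obtain ⟨w, hw1, hw2⟩ : ∃ w, φ ⬝ᵥ w = 1 ∧
      ((φ ⬝ᵥ x) * (y ⬝ᵥ B *ᵥ w) = 0 ∨ (φ ⬝ᵥ x) * (y ⬝ᵥ B *ᵥ w) = y ⬝ᵥ B *ᵥ x) := by
    by_cases hx : φ ⬝ᵥ x = 0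
    · obtain ⟨w, hw⟩ : ∃ w, f w ≠ 0 := by
        by_contra! hcon
        exact hf0 (LinearMap.ext hcon)
      refine ⟨(f w)⁻¹ • w, ?_, Or.inl (by rw [hx, zero_mul])⟩
      rw [hφ, map_smul, smul_eq_mul, inv_mul_cancel₀ hw]
    · refine ⟨(φ ⬝ᵥ x)⁻¹ • x, ?_, Or.inr ?_⟩
      · rw [dotProduct_smul, smul_eq_mul, inv_mul_cancel₀ hx]
      · rw [mulVec_smul, dotProduct_smul, smul_eq_mul, mul_inv_cancel_left₀ hx]
  have hkp : (0 : ℝ) < (n + 2 * m : ℕ) := by exact_mod_cast Nat.pos_of_ne_zero hk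
  obtain ⟨t, ht0, ht1, ht⟩ := h.perturb B hBc φ (B *ᵥ w)
    (fun z hz => by rw [hφ]; exact hf ((hSm z).2 hz)) (1 / (2 * (n + 2 * m : ℕ))) (by positivity)
  have hmul : ∀ z, (B * (1 + vecMulVec (t • w) φ)) *ᵥ z
      = B *ᵥ z + (t * (φ ⬝ᵥ z)) • (B *ᵥ w) := by
    intro z
    rw [← mulVec_mulVec, add_mulVec, one_mulVec, vecMulVec_mulVec, mulVec_add, op_smul_eq_smul,
      smul_smul, mulVec_smul, mul_comm]
  have h1 := FF_le h y x m B hB (B * (1 + vecMulVec (t • w) φ))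
    (1 + 1 / (2 * (n + 2 * m : ℕ)) * t) (by positivity) (fun z => by rw [hmul]; exact ht z)
  have h2 : (1 + t) * FF y x m B ≤ FF y x m (B * (1 + vecMulVec (t • w) φ)) := by
    unfold FF
    rw [hmul, det_mul, det_one_add_vv, dotProduct_smul, hw1, abs_mul, dotProduct_add,
      dotProduct_smul, smul_eq_mul, smul_eq_mul, mul_one, abs_of_pos (by linarith : 0 < 1 + t),
      mul_assoc t]
    have : (y ⬝ᵥ B *ᵥ x) ^ 2 ≤ (y ⬝ᵥ B *ᵥ x + t * (φ ⬝ᵥ x * y ⬝ᵥ B *ᵥ w)) ^ 2 := by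
      rcases hw2 with e | e <;> rw [e]
      · simp
      · nlinarith [sq_nonneg (y ⬝ᵥ B *ᵥ x), mul_nonneg ht0.le (sq_nonneg (y ⬝ᵥ B *ᵥ x)), mul_nonneg (sq_nonneg t) (sq_nonneg (y ⬝ᵥ B *ᵥ x))]
    have h3 := pow_le_pow_left₀ (sq_nonneg _) this m
    have h4 := mul_le_mul_of_nonneg_left h3 (by positivity : 0 ≤ |B.det| * (1 + t))
    linarith
  have h3 : (1 + 1 / (2 * (n + 2 * m : ℕ)) * t) ^ (n + 2 * m) < 1 + t := by
    have e1 : 1 + 1 / (2 * (n + 2 * m : ℕ)) * t ≤ Real.exp (1 / (2 * (n + 2 * m : ℕ)) * t) := by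
      linarith [Real.add_one_le_exp (1 / (2 * ((n + 2 * m : ℕ) : ℝ)) * t)]
    have e2 := pow_le_pow_left₀ (by positivity) e1 (n + 2 * m)
    rw [← Real.exp_nat_mul] at e2
    have e3 : ((n + 2 * m : ℕ) : ℝ) * (1 / (2 * (n + 2 * m : ℕ)) * t) = t / 2 := by
      field_simp
    rw [e3] at e2
    have e4 : Real.exp (t / 2) < 1 + t := by
      have e5 := Real.add_one_le_exp (-(t / 2))
      rw [Real.exp_neg] at e5
      have e6 := Real.exp_pos (t / 2)
      have e7 : (-(t / 2) + 1) * Real.exp (t / 2) ≤ 1 := by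
        rwa [← le_div_iff₀ e6, one_div]
      by_contra! hcon
      nlinarith [mul_le_mul_of_nonneg_left hcon (by linarith : 0 ≤ -(t / 2) + 1)]
    linarith
  nlinarith

theorem dot_cs {n : ℕ} (x y : Fin n → ℝ) : (x ⬝ᵥ y) ^ 2 ≤ (x ⬝ᵥ x) * (y ⬝ᵥ y) := by
  have := Finset.sum_mul_sq_le_sq_mul_sq Finset.univ x y
  simpa [dotProduct, sq] using this

theorem orth_dot {n : ℕ} (Q : Matrix (Fin n) (Fin n) ℝ) (hQ : Qᵀ * Q = 1) (x : Fin n → ℝ) :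
    Q *ᵥ x ⬝ᵥ Q *ᵥ x = x ⬝ᵥ x := by
  rw [dotProduct_mulVec, ← mulVec_transpose, mulVec_mulVec, hQ, one_mulVec]

theorem dot_pos {n : ℕ} {x : Fin n → ℝ} (hx : x ≠ 0) : 0 < x ⬝ᵥ x :=
  lt_of_le_of_ne (Finset.sum_nonneg fun i _ => mul_self_nonneg _)
    (fun e => hx (dotProduct_self_eq_zero.1 e.symm))

theorem main_ineq {n : ℕ} {N : (Fin n → ℝ) → ℝ} (h : IsNm N)
    (opN : ((Fin n → ℝ) →ₗ[ℝ] (Fin n → ℝ)) → ℝ)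
    (hopN : ∀ u : (Fin n → ℝ) →ₗ[ℝ] (Fin n → ℝ),
      IsLeast {C : ℝ | 0 ≤ C ∧ ∀ x, N (u x) ≤ C * N x} (opN u))
    (hiso : ∀ u : (Fin n → ℝ) →ₗ[ℝ] (Fin n → ℝ), (∀ x, N (u x) = N x) →
      (LinearMap.toMatrix' u)ᵀ * LinearMap.toMatrix' u = 1)
    (hnorming : ∀ u : (Fin n → ℝ) →ₗ[ℝ] (Fin n → ℝ),
      ∃ S : Submodule ℝ (Fin n → ℝ),
        (S : Set (Fin n → ℝ)) = {x : Fin n → ℝ | N (u x) = opN u * N x})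
    (x y : Fin n → ℝ) (hx : N x = 1) (hy : N y = 1) : y ⬝ᵥ y ≤ x ⬝ᵥ x := by
  by_contra! hlt
  have hx0 : x ≠ 0 := by
    rintro rfl
    rw [(h.zero 0).2 rfl] at hx
    norm_num at hx
  have hqx := dot_pos hx0
  have hqy : 0 < y ⬝ᵥ y := hqx.trans hlt
  obtain ⟨f, hfx, hfy, hfN⟩ : ∃ f : Fin n → ℝ, |f ⬝ᵥ x| = 1 ∧ 0 ≤ f ⬝ᵥ y ∧
      ∀ z, |f ⬝ᵥ z| ≤ N z := by
    obtain ⟨f, hf1, hf2⟩ := h.hahn x hx0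
    rcases le_total 0 (f ⬝ᵥ y) with hs | hs
    · exact ⟨f, by rw [hf1, hx, abs_one], hs, hf2⟩
    · refine ⟨-f, by rw [neg_dotProduct, abs_neg, hf1, hx, abs_one], ?_, fun z => ?_⟩
      · rw [neg_dotProduct]; linarith
      · rw [neg_dotProduct, abs_neg]; exact hf2 z
  -- choice of ε
  obtain ⟨ε, hε0, hε1, hε⟩ : ∃ ε : ℝ, 0 < ε ∧ ε < 1 ∧
      x ⬝ᵥ x < ((1 - ε) / (1 + ε)) ^ 2 * (y ⬝ᵥ y) := by
    have hc : ContinuousAt (fun ε : ℝ => ((1 - ε) / (1 + ε)) ^ 2 * (y ⬝ᵥ y)) 0 := by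
      have : (1 : ℝ) + 0 ≠ 0 := by norm_num
      fun_prop (disch := assumption)
    have h1 := hc.eventually (lt_mem_nhds (a := x ⬝ᵥ x) (by simpa using hlt))
    obtain ⟨r, hr, hball⟩ := Metric.eventually_nhds_iff.1 h1
    refine ⟨min (r / 2) (1 / 2), by positivity, (min_le_right _ _).trans_lt (by norm_num), hball ?_⟩
    rw [Real.dist_eq, sub_zero, abs_of_pos (by positivity)]
    exact (min_le_left _ _).trans_lt (by linarith)
  set A : Matrix (Fin n) (Fin n) ℝ := ε • (1 + vecMulVec (ε⁻¹ • y) f) with hA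
  have hAz : ∀ z, A *ᵥ z = ε • z + (f ⬝ᵥ z) • y := by
    intro z
    rw [hA, smul_mulVec, add_mulVec, one_mulVec, vecMulVec_mulVec, op_smul_eq_smul, smul_add,
      smul_smul, smul_smul]
    congr 2
    field_simp
  have hAN : ∀ z, N (A *ᵥ z) ≤ (1 + ε) * N z := by
    intro z
    rw [hAz]
    refine (h.add _ _).trans ?_
    rw [h.smul, h.smul, hy, abs_of_pos hε0]
    linarith [hfN z]
  have hdet : 0 < |A.det| := by
    rw [abs_pos, hA, det_smul, det_one_add_vv, dotProduct_smul, smul_eq_mul]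
    have : 0 ≤ ε⁻¹ * (f ⬝ᵥ y) := by positivity
    positivity
  have hdot : ((1 - ε) * (y ⬝ᵥ y)) ^ 2 ≤ (y ⬝ᵥ A *ᵥ x) ^ 2 := by
    rw [hAz, dotProduct_add, dotProduct_smul, dotProduct_smul, smul_eq_mul, smul_eq_mul]
    have hyx : |y ⬝ᵥ x| ≤ y ⬝ᵥ y := by
      apply abs_le_of_sq_le_sq _ hqy.le
      have := dot_cs y x
      nlinarith
    rw [abs_le] at hyx
    rw [sq_le_sq, abs_of_pos (mul_pos (by linarith) hqy)]
    rcases abs_eq (zero_le_one) |>.1 hfx with e | e <;> rw [e]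
    · refine le_trans ?_ (le_abs_self _)
      nlinarith
    · refine le_trans ?_ (neg_le_abs _)
      nlinarith
  -- choice of m
  set b := (y ⬝ᵥ y) * (x ⬝ᵥ x) with hb
  set a := ((1 - ε) * (y ⬝ᵥ y) / (1 + ε)) ^ 2 with ha
  have hbpos : 0 < b := mul_pos hqy hqx
  have hab : b < a := by
    have : a = (y ⬝ᵥ y) * (((1 - ε) / (1 + ε)) ^ 2 * (y ⬝ᵥ y)) := by rw [ha]; ring
    rw [this, hb]
    gcongr
  set D := |A.det| / (1 + ε) ^ n with hD
  have hDpos : 0 < D := by positivity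
  obtain ⟨m, hm⟩ := pow_unbounded_of_one_lt (1 / D) ((one_lt_div hbpos).2 hab)
  have hm' : 1 / D < (a / b) ^ (m + 1) :=
    hm.trans_le (pow_le_pow_right₀ ((one_lt_div hbpos).2 hab).le (Nat.le_succ m))
  have hmain : b ^ (m + 1) < D * a ^ (m + 1) := by
    rw [div_pow, div_lt_div_iff₀ hDpos (by positivity)] at hm'
    linarith
  -- maximizer
  obtain ⟨B, hBc, hBm⟩ := h.compact_ball.exists_isMaxOn ⟨1, fun z => by simp⟩
    (f := FF y x (m + 1)) (by
      unfold FF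
      fun_prop)
  have hBm' : ∀ A : Matrix (Fin n) (Fin n) ℝ, (∀ z, N (A *ᵥ z) ≤ N z) →
    FF y x (m + 1) A ≤ FF y x (m + 1) B := fun A hA => hBm hA
  have hFA := FF_le h y x (m + 1) B hBm' A (1 + ε) (by linarith) hAN
  have hlow : D * a ^ (m + 1) ≤ FF y x (m + 1) B := by
    have h1 : |A.det| * (((1 - ε) * (y ⬝ᵥ y)) ^ 2) ^ (m + 1) ≤ FF y x (m + 1) A := by
      unfold FF
      gcongr
    have h2 : D * a ^ (m + 1) * (1 + ε) ^ (n + 2 * (m + 1))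
        = |A.det| * (((1 - ε) * (y ⬝ᵥ y)) ^ 2) ^ (m + 1) := by
      rw [hD, ha, div_pow, div_pow, pow_add _ n, pow_mul _ 2]
      field_simp
    have h3 : (0 : ℝ) < (1 + ε) ^ (n + 2 * (m + 1)) := by positivity
    rw [← h2] at h1
    have := h1.trans hFA
    rw [mul_comm] at this
    exact le_of_mul_le_mul_left this h3
  have hiB := key h opN hopN hnorming y x (m + 1) (by omega) B hBc hBm'
    (lt_of_lt_of_le (by positivity) hlow)
  have hO := hiso (toLin' B) (by simpa using hiB)
  rw [LinearMap.toMatrix'_toLin'] at hO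
  have hdB : |B.det| = 1 := by
    have := congrArg det hO
    rw [det_mul, det_transpose, det_one] at this
    rw [← sq_eq_sq₀ (abs_nonneg _) zero_le_one, sq_abs]
    linarith
  have hup : FF y x (m + 1) B ≤ b ^ (m + 1) := by
    unfold FF
    rw [hdB, one_mul]
    have := dot_cs y (B *ᵥ x)
    rw [orth_dot B hO] at this
    gcongr
  linarith


/-- Let `N` be a norm on `ℝⁿ` such that every linear `N`-isometry of `ℝⁿ` is an
orthogonal matrix, and such that for every linear operator `u` the set of norming
vectors `{x : N (u x) = opN u * N x}` is a linear subspace. Then every orthogonal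
matrix is an `N`-isometry. -/
theorem orthogonal_isometry_of_norming_subspaces
    {n : ℕ}
    (N : (Fin n → ℝ) → ℝ)
    (hN_def : ∀ x, N x = 0 ↔ x = 0)
    (hN_smul : ∀ (a : ℝ) (x : Fin n → ℝ), N (a • x) = |a| * N x)
    (hN_add : ∀ x y, N (x + y) ≤ N x + N y)
    (opN : ((Fin n → ℝ) →ₗ[ℝ] (Fin n → ℝ)) → ℝ)
    (hopN : ∀ u : (Fin n → ℝ) →ₗ[ℝ] (Fin n → ℝ),
      IsLeast {C : ℝ | 0 ≤ C ∧ ∀ x, N (u x) ≤ C * N x} (opN u))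
    (hiso : ∀ u : (Fin n → ℝ) →ₗ[ℝ] (Fin n → ℝ), (∀ x, N (u x) = N x) →
      (LinearMap.toMatrix' u)ᵀ * LinearMap.toMatrix' u = 1)
    (hnorming : ∀ u : (Fin n → ℝ) →ₗ[ℝ] (Fin n → ℝ),
      ∃ S : Submodule ℝ (Fin n → ℝ),
        (S : Set (Fin n → ℝ)) = {x : Fin n → ℝ | N (u x) = opN u * N x})
    (Q : Matrix (Fin n) (Fin n) ℝ) (hQ : Qᵀ * Q = 1) :
    ∀ x : Fin n → ℝ, N (Q.mulVec x) = N x := by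
  intro x
  have h : IsNm N := ⟨hN_def, hN_smul, hN_add⟩
  by_cases hx : x = 0
  · subst hx; simp
  have hqx := dot_pos hx
  have hQx : Q *ᵥ x ≠ 0 := by
    intro e
    have := orth_dot Q hQ x
    rw [e] at this
    simp at this
    exact hqx.ne this
  have hu : ∀ z, z ≠ 0 → N ((N z)⁻¹ • z) = 1 := fun z hz => by
    have := h.pos hz
    rw [h.smul, abs_of_pos (inv_pos.2 this), inv_mul_cancel₀ this.ne']
  have h1 := main_ineq h opN hopN hiso hnorming _ _ (hu _ hx) (hu _ hQx)
  have h2 := main_ineq h opN hopN hiso hnorming _ _ (hu _ hQx) (hu _ hx)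
  have e := le_antisymm h1 h2
  simp only [dotProduct_smul, smul_dotProduct, smul_eq_mul, orth_dot Q hQ] at e
  rw [← mul_assoc, ← mul_assoc] at e
  have e2 := mul_right_cancel₀ hqx.ne' e
  have e3 := (mul_self_inj (inv_nonneg.2 (h.nonneg _)) (inv_nonneg.2 (h.nonneg _))).1 e2
  exact inv_injective e3
end
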